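/- arXiv:dg-ga/9609012 — 3 statements merged into one kernel-verified Lean document; each statement's English description precedes it below -/
import Mathlib

section
/- (Reciprocity formula for Gauss sums, one-dimensional case.) Let a be a positive even integer, Q a nonzero integer, and w a rational number with a·w ∈ ℤ. Then Σ_{q=0}^{a-1} exp(πi q² Q / a + 2πi w q) = |a/Q|^{1/2} · exp((πi/4)·sgn(Q)) · Σ_{m=0}^{|Q|-1} exp(−πi a (m + w)² / Q). -/
open Complex

open Filter Topology

theorem summable_exp_neg_div_mul_int_add_sq {β : ℂ} (hβ : 0 < β.re) (s : ℝ) :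
    Summable fun n : ℤ ↦ cexp (-Real.pi / β * (n + s) ^ 2) := by
  have hβ0 : β ≠ 0 := fun h ↦ by simp [h] at hβ
  have him : 0 < (I / β).im := by
    rw [div_eq_mul_inv, I_mul_im, inv_re]
    exact div_pos hβ (normSq_pos.mpr hβ0)
  refine (((summable_jacobiTheta₂_term_iff (I * s / β) (I / β)).mpr him).mul_left
    (cexp (-Real.pi / β * s ^ 2))).congr fun n ↦ ?_
  rw [jacobiTheta₂_term, ← Complex.exp_add]
  congr 1
  linear_combination (Real.pi * 2 * n * s / β + Real.pi * n ^ 2 / β) * I_sq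

theorem tendsto_tsum_exp_neg_quadratic {ι : Type*} {l : Filter ι} [l.IsCountablyGenerated]
    {α : ι → ℂ}
    (hα : Tendsto (fun t ↦ (α t).re) l atTop) (x : ℝ) :
    Tendsto (fun t ↦ ∑' n : ℤ, cexp (-Real.pi * α t * n ^ 2 + 2 * Real.pi * (-(I * x)) * n))
      l (𝓝 1) := by
  have hnorm (t : ι) (n : ℤ) :
      ‖cexp (-Real.pi * α t * n ^ 2 + 2 * Real.pi * (-(I * x)) * n)‖
        = Real.exp (-Real.pi * (n : ℝ) ^ 2 * (α t).re) := by
    rw [norm_exp]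
    congr 1
    rw [show -Real.pi * α t * n ^ 2 + 2 * Real.pi * (-(I * x)) * n
      = ((-Real.pi * (n : ℝ) ^ 2 : ℝ) : ℂ) * α t + ((-2 * Real.pi * x * n : ℝ) : ℂ) * I by
        push_cast; ring]
    simp only [add_re, re_ofReal_mul, I_re, mul_zero, add_zero]
  have hsum : Summable fun n : ℤ ↦ Real.exp (-Real.pi * (n : ℝ) ^ 2) := by
    simpa [norm_jacobiTheta₂_term] using
      ((summable_jacobiTheta₂_term_iff 0 I).mpr (by simp)).norm
  rw [show (1 : ℂ) = ∑' n : ℤ, if n = 0 then 1 else 0 by simp]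
  refine tendsto_tsum_of_dominated_convergence hsum (fun n ↦ ?_) ?_
  · split_ifs with hn
    · simpa [hn] using tendsto_const_nhds
    · rw [tendsto_zero_iff_norm_tendsto_zero]
      simp_rw [hnorm]
      have hn' : 0 < (n : ℝ) ^ 2 := by positivity
      exact Real.tendsto_exp_atBot.comp
        (hα.const_mul_atTop_of_neg (by nlinarith [Real.pi_pos]))
  · filter_upwards [hα.eventually_ge_atTop 1] with t ht n
    rw [hnorm, Real.exp_le_exp]
    nlinarith [mul_nonneg Real.pi_pos.le (sq_nonneg (n : ℝ))]

theorem ofReal_mul_cpow_of_pos {r : ℝ} (hr : 0 < r) (z w : ℂ) :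
    ((r : ℂ) * z) ^ w = (r : ℂ) ^ w * z ^ w := by
  rcases eq_or_ne z 0 with rfl | hz
  · rcases eq_or_ne w 0 with rfl | hw
    · simp
    · simp [zero_cpow hw]
  · have hr' : (r : ℂ) ≠ 0 := ofReal_ne_zero.mpr hr.ne'
    rw [cpow_def_of_ne_zero (mul_ne_zero hr' hz), cpow_def_of_ne_zero hr',
      cpow_def_of_ne_zero hz, log_ofReal_mul hr hz, ← exp_add, ofReal_log hr.le, add_mul]

theorem sq_cpow_half {r : ℝ} (hr : 0 < r) : ((r ^ 2 : ℝ) : ℂ) ^ (1 / 2 : ℂ) = r := by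
  rw [show (1 / 2 : ℂ) = ((1 / 2 : ℝ) : ℂ) by push_cast; rfl, ← ofReal_cpow (by positivity),
    ← Real.sqrt_eq_rpow, Real.sqrt_sq hr.le]

theorem tsum_exp_neg_div_mul_add_sq {β : ℂ} (hβ : 0 < β.re) {N : ℕ} (hN : 0 < N) (s : ℝ) :
    ∑' k : ℤ, cexp (-Real.pi / β * (k * N + s) ^ 2) =
      β ^ (1 / 2 : ℂ) / N * ∑' n : ℤ, cexp (-Real.pi * (((1 / N ^ 2 : ℝ) : ℂ) * β) * n ^ 2
        + 2 * Real.pi * (-(I * (s / N : ℝ))) * n) := by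
  have hN' : (0 : ℝ) < N := by exact_mod_cast hN
  have hNc : (N : ℂ) ≠ 0 := by exact_mod_cast hN.ne'
  have hβ0 : β ≠ 0 := fun h ↦ by simp [h] at hβ
  rw [Complex.tsum_exp_neg_quadratic (by rw [re_ofReal_mul]; positivity),
    ofReal_mul_cpow_of_pos (by positivity),
    show (1 / (N : ℝ) ^ 2 : ℝ) = (1 / N : ℝ) ^ 2 by ring, sq_cpow_half (by positivity),
    ← mul_assoc]
  have hβ2 : β ^ (1 / 2 : ℂ) ≠ 0 := by simp [cpow_eq_zero_iff, hβ0]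
  rw [show β ^ (1 / 2 : ℂ) / N * (1 / (((1 / N : ℝ) : ℂ) * β ^ (1 / 2 : ℂ))) = 1 by
    push_cast; field_simp, one_mul]
  refine tsum_congr fun k ↦ ?_
  congr 1
  push_cast
  rw [show (k : ℂ) + I * -(I * (s / N)) = (k * N + s) / N by
    field_simp; linear_combination -(s : ℂ) * I_sq]
  field_simp

theorem tsum_int_eq_sum_residues {f : ℤ → ℂ} (hf : Summable f) {N : ℕ} (hN : 0 < N) :
    ∑' n : ℤ, f n = ∑ m ∈ Finset.range N, ∑' k : ℤ, f (k * N + m) := by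
  have : NeZero N := ⟨hN.ne'⟩
  let e := (Equiv.prodComm (Fin N) ℤ).trans (Int.divModEquiv N).symm
  have hsum : Summable fun p ↦ f (e p) := e.summable_iff.mpr hf
  rw [← e.tsum_eq, hsum.tsum_prod, tsum_fintype,
    ← Fin.sum_univ_eq_sum_range (fun m : ℕ ↦ ∑' k : ℤ, f (k * N + m))]
  rfl

theorem exists_norm_le_of_periodic_int {g : ℤ → ℂ} {N : ℕ} (hN : 0 < N)
    (hg : Function.Periodic g N) : ∃ C, ∀ n, ‖g n‖ ≤ C := by
  refine ⟨∑ m ∈ Finset.range N, ‖g m‖, fun n ↦ ?_⟩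
  obtain ⟨m, hm⟩ : ∃ m : ℕ, n % N = m :=
    Int.eq_ofNat_of_zero_le (Int.emod_nonneg n (b := N) (by positivity))
  have hmN : m < N := by
    have := Int.emod_lt_of_pos n (b := N) (by positivity)
    omega
  have hgn : g n = g m := by
    rw [← hm, ← hg.int_mul (n / N) (n % N), Int.cast_id, Int.emod_add_ediv_mul]
  rw [hgn]
  exact Finset.single_le_sum (f := fun m : ℕ ↦ ‖g m‖) (fun _ _ ↦ norm_nonneg _)
    (Finset.mem_range.mpr hmN)

theorem tsum_periodic_mul_gaussian {β : ℂ} (hβ : 0 < β.re) {N : ℕ} (hN : 0 < N)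
    {g : ℤ → ℂ} (hg : Function.Periodic g N) (s : ℝ) :
    (∑' n : ℤ, g n * cexp (-Real.pi / β * (n + s) ^ 2)) / β ^ (1 / 2 : ℂ) =
      ∑ m ∈ Finset.range N, g m / N *
        ∑' n : ℤ, cexp (-Real.pi * (((1 / N ^ 2 : ℝ) : ℂ) * β) * n ^ 2
          + 2 * Real.pi * (-(I * ((m + s) / N : ℝ))) * n) := by
  have hβ0 : β ≠ 0 := fun h ↦ by simp [h] at hβ
  have hβ2 : β ^ (1 / 2 : ℂ) ≠ 0 := by simp [cpow_eq_zero_iff, hβ0]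
  obtain ⟨C, hC⟩ := exists_norm_le_of_periodic_int hN hg
  have hsum : Summable fun n : ℤ ↦ g n * cexp (-Real.pi / β * (n + s) ^ 2) := by
    refine ((summable_exp_neg_div_mul_int_add_sq hβ s).norm.mul_left C).of_norm_bounded
      fun n ↦ ?_
    rw [norm_mul]
    exact mul_le_mul_of_nonneg_right (hC n) (norm_nonneg _)
  rw [tsum_int_eq_sum_residues hsum hN, Finset.sum_div]
  refine Finset.sum_congr rfl fun m _ ↦ ?_
  have hterm (k : ℤ) : g (k * N + m) * cexp (-Real.pi / β * (((k * N + m : ℤ) : ℂ) + s) ^ 2)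
      = g m * cexp (-Real.pi / β * (k * N + ((m + s : ℝ) : ℂ)) ^ 2) := by
    rw [add_comm (k * (N : ℤ)) m, show g (m + k * N) = g m from hg.int_mul k m]
    congr 3
    push_cast
    ring
  rw [tsum_congr hterm, tsum_mul_left, tsum_exp_neg_div_mul_add_sq hβ hN (m + s)]
  field_simp

theorem tendsto_tsum_periodic_mul_gaussian {ι : Type*} {l : Filter ι} [l.IsCountablyGenerated]
    {β : ι → ℂ} (hβ : Tendsto (fun t ↦ (β t).re) l atTop) {N : ℕ} (hN : 0 < N)
    {g : ℤ → ℂ} (hg : Function.Periodic g N) (s : ℝ) :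
    Tendsto (fun t ↦ (∑' n : ℤ, g n * cexp (-Real.pi / β t * (n + s) ^ 2)) / β t ^ (1 / 2 : ℂ))
      l (𝓝 ((∑ m ∈ Finset.range N, g m) / N)) := by
  have hα : Tendsto (fun t ↦ (((1 / N ^ 2 : ℝ) : ℂ) * β t).re) l atTop := by
    simp_rw [re_ofReal_mul]
    exact hβ.const_mul_atTop (by positivity)
  have hlim := tendsto_finsetSum (Finset.range N) fun m _ ↦
    (tendsto_tsum_exp_neg_quadratic hα ((m + s) / N)).const_mul (g m / N)
  simp only [mul_one, ← Finset.sum_div] at hlim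
  refine hlim.congr' ?_
  filter_upwards [hβ.eventually_gt_atTop 0] with t ht
  exact (tsum_periodic_mul_gaussian ht hN hg s).symm

theorem neg_I_mul_cpow_half {x : ℝ} (hx : x ≠ 0) :
    (-I * x) ^ (1 / 2 : ℂ)
      = (Real.sqrt |x| : ℂ) * cexp (-(Real.pi * I / 4 * (SignType.sign x : ℝ))) := by
  have hsqrt : ((|x| : ℝ) : ℂ) ^ (1 / 2 : ℂ) = (Real.sqrt |x| : ℂ) := by
    rw [Real.sqrt_eq_rpow, ofReal_cpow (abs_nonneg x)]
    push_cast
    rfl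
  rcases hx.lt_or_gt with h | h
  · rw [show -I * (x : ℂ) = ((|x| : ℝ) : ℂ) * I by rw [abs_of_neg h]; push_cast; ring,
      ofReal_mul_cpow_of_pos (abs_pos.mpr hx), hsqrt, cpow_def_of_ne_zero I_ne_zero, log_I,
      sign_neg h]
    congr 2
    simp
    ring
  · rw [show -I * (x : ℂ) = ((|x| : ℝ) : ℂ) * -I by rw [abs_of_pos h]; ring,
      ofReal_mul_cpow_of_pos (abs_pos.mpr hx), hsqrt,
      cpow_def_of_ne_zero (neg_ne_zero.mpr I_ne_zero), log_neg_I, sign_pos h]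
    congr 2
    simp
    ring

theorem tsum_gaussian_twisted (x w : ℝ) (hx : x ≠ 0) {t : ℝ} (ht : 0 < t) :
    ∑' n : ℤ, cexp (Real.pi * I * n ^ 2 * x + 2 * Real.pi * I * w * n)
        * cexp (-Real.pi / t * (n + (0 : ℝ)) ^ 2) =
      1 / ((1 / t : ℝ) - I * x) ^ (1 / 2 : ℂ) *
        ∑' n : ℤ, cexp (-Real.pi * I * (n + w) ^ 2 / x)
          * cexp (-Real.pi / (t * (I * x * ((1 / t : ℝ) - I * x))) * (n + w) ^ 2) := by
  set A : ℂ := (1 / t : ℝ) - I * x with hA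
  have hAre : 0 < A.re := by simp [hA, ht]
  have hA0 : A ≠ 0 := fun h ↦ by simp [h] at hAre
  have hxc : (x : ℂ) ≠ 0 := ofReal_ne_zero.mpr hx
  have htc : (t : ℂ) ≠ 0 := ofReal_ne_zero.mpr ht.ne'
  have htA : t * A = 1 - t * I * x := by
    rw [hA]; push_cast; field_simp
  have hAinv : 1 / A = I / x + 1 / (t * (I * x * A)) := by
    have := I_ne_zero
    field_simp
    linear_combination htA - t * A * I_sq
  calc _ = ∑' n : ℤ, cexp (-Real.pi * A * n ^ 2 + 2 * Real.pi * (I * w) * n) := by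
        refine tsum_congr fun n ↦ ?_
        rw [← exp_add]
        congr 1
        rw [hA]
        push_cast
        field_simp
        ring
    _ = _ := by
        rw [Complex.tsum_exp_neg_quadratic hAre, ← (Equiv.neg ℤ).tsum_eq]
        congr 1
        refine tsum_congr fun n ↦ ?_
        rw [← exp_add]
        congr 1
        have hsq : (((Equiv.neg ℤ n : ℤ) : ℂ) + I * (I * w)) ^ 2 = (n + w) ^ 2 := by
          rw [← mul_assoc, I_mul_I, Equiv.neg_apply]
          push_cast
          ring
        rw [hsq]
        linear_combination (-Real.pi * ((n : ℂ) + w) ^ 2) * hAinv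

theorem sum_periodic_gaussian_reciprocity {x w : ℝ} (hx : x ≠ 0) {a b : ℕ} (ha : 0 < a)
    (hb : 0 < b) (hxab : |x| = b / a)
    (hper : Function.Periodic
      (fun n : ℤ ↦ cexp (Real.pi * I * n ^ 2 * x + 2 * Real.pi * I * w * n)) a)
    (hper' : Function.Periodic (fun n : ℤ ↦ cexp (-Real.pi * I * (n + w) ^ 2 / x)) b) :
    ∑ q ∈ Finset.range a, cexp (Real.pi * I * q ^ 2 * x + 2 * Real.pi * I * w * q) =
      1 / (-I * x) ^ (1 / 2 : ℂ) *
        ∑ m ∈ Finset.range b, cexp (-Real.pi * I * (m + w) ^ 2 / x) := by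
  have hre (t : ℝ) (ht : 0 < t) : (t * (I * x * ((1 / t : ℝ) - I * x))).re = t * x ^ 2 := by
    rw [re_ofReal_mul]
    congr 1
    simp
    ring
  have h1 := tendsto_tsum_periodic_mul_gaussian (l := atTop) (β := fun t : ℝ ↦ (t : ℂ))
    (by simpa only [ofReal_re] using! tendsto_id) ha hper 0
  have h2 := tendsto_tsum_periodic_mul_gaussian (l := atTop)
    (β := fun t : ℝ ↦ t * (I * x * ((1 / t : ℝ) - I * x)))
    ((tendsto_id.atTop_mul_const (r := x ^ 2) (by positivity)).congr' (by
      filter_upwards [eventually_gt_atTop 0] with t ht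
      exact (hre t ht).symm)) hb hper' w
  have hA : Tendsto (fun t : ℝ ↦ ((1 / t : ℝ) : ℂ) - I * x) atTop (𝓝 (-I * x)) := by
    have : Tendsto (fun t : ℝ ↦ ((1 / t : ℝ) : ℂ)) atTop (𝓝 ((0 : ℝ) : ℂ)) :=
      (continuous_ofReal.tendsto 0).comp
        (tendsto_inv_atTop_zero.congr fun t ↦ (one_div t).symm)
    simpa using this.sub_const (I * (x : ℂ))
  have hroot : (I * x * (-I * x)) ^ (1 / 2 : ℂ) = ((b / a : ℝ) : ℂ) := by
    rw [← hxab, ← sq_cpow_half (abs_pos.mpr hx), sq_abs]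
    congr 1
    push_cast
    linear_combination -(x : ℂ) ^ 2 * I_sq
  have h3 : Tendsto (fun t : ℝ ↦ (I * x * ((1 / t : ℝ) - I * x)) ^ (1 / 2 : ℂ)
      / ((1 / t : ℝ) - I * x) ^ (1 / 2 : ℂ)) atTop
      (𝓝 (((b / a : ℝ) : ℂ) / (-I * x) ^ (1 / 2 : ℂ))) := by
    rw [← hroot]
    refine ((hA.const_mul (I * (x : ℂ))).cpow tendsto_const_nhds ?_).div
      (hA.cpow tendsto_const_nhds ?_) ?_
    · left
      simp
      positivity
    · right
      simpa using hx
    · simp [cpow_eq_zero_iff, hx]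
  have h4 := tendsto_nhds_unique h1 ((h3.mul h2).congr' ?_)
  · have hac : (a : ℂ) ≠ 0 := by exact_mod_cast ha.ne'
    have hbc : (b : ℂ) ≠ 0 := by exact_mod_cast hb.ne'
    simp only [Int.cast_natCast] at h4
    rw [(div_eq_iff hac).mp h4]
    push_cast
    field_simp
  · filter_upwards [eventually_gt_atTop 0] with t ht
    have htc : (t : ℂ) ^ (1 / 2 : ℂ) ≠ 0 := by simp [cpow_eq_zero_iff, ht.ne']
    have hne : I * x * ((1 / t : ℝ) - I * x) ≠ 0 := fun h ↦ by
      have := hre t ht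
      rw [h] at this
      simp [hx, ht.ne'] at this
    have hnec : (I * x * ((1 / t : ℝ) - I * x)) ^ (1 / 2 : ℂ) ≠ 0 := by
      simp only [ne_eq, cpow_eq_zero_iff, hne, false_and, not_false_eq_true]
    rw [tsum_gaussian_twisted x w hx ht, ofReal_mul_cpow_of_pos ht]
    generalize (∑' n : ℤ, cexp (-Real.pi * I * (n + w) ^ 2 / x) * _) = S
    field_simp

/-- One-dimensional reciprocity formula for Gauss sums. -/
theorem stmt_3 (a : ℕ) (ha : 0 < a) (hae : Even a) (Q : ℤ) (hQ : Q ≠ 0)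
    (w : ℚ) (hw : ∃ z : ℤ, (a : ℚ) * w = (z : ℚ)) :
    ∑ q ∈ Finset.range a,
        Complex.exp (Real.pi * Complex.I * (q : ℂ) ^ 2 * (Q : ℂ) / (a : ℂ)
          + 2 * Real.pi * Complex.I * (w : ℂ) * (q : ℂ))
      = (Real.sqrt |(a : ℝ) / (Q : ℝ)| : ℂ)
          * Complex.exp (Real.pi * Complex.I / 4 * (Q.sign : ℂ))
          * ∑ m ∈ Finset.range Q.natAbs,
              Complex.exp (-(Real.pi : ℂ) * Complex.I * (a : ℂ)
                * ((m : ℂ) + (w : ℂ)) ^ 2 / (Q : ℂ)) := by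
  obtain ⟨z, hz⟩ := hw
  obtain ⟨c, hc⟩ := hae
  have hzc : (a : ℂ) * w = z := by exact_mod_cast congrArg (fun r : ℚ ↦ (r : ℂ)) hz
  have hcc : (a : ℂ) = c + c := by exact_mod_cast hc
  have hac : (a : ℂ) ≠ 0 := by exact_mod_cast ha.ne'
  have haR : (a : ℝ) ≠ 0 := by exact_mod_cast ha.ne'
  have hQc : (Q : ℂ) ≠ 0 := by exact_mod_cast hQ
  have hQR : (Q : ℝ) ≠ 0 := by exact_mod_cast hQ
  have hx : (Q : ℝ) / a ≠ 0 := div_ne_zero hQR haR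
  have hperQ : Function.Periodic
      (fun n : ℤ ↦ cexp (-Real.pi * I * (n + (w : ℝ)) ^ 2 / ((Q : ℝ) / a : ℝ))) Q := by
    intro n
    refine exp_eq_exp_iff_exists_int.mpr ⟨-(a * n + z + c * Q), ?_⟩
    push_cast
    field_simp
    linear_combination (-2 * Q) * hzc - Q ^ 2 * hcc
  have key := sum_periodic_gaussian_reciprocity (x := Q / a) (w := w) hx ha
    (Int.natAbs_pos.mpr hQ) (by rw [abs_div, Nat.abs_cast, Nat.cast_natAbs, Int.cast_abs]) ?_ ?_
  · have hsign : (SignType.sign ((Q : ℝ) / a) : ℝ) = (Q.sign : ℝ) := by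
      have haR' : (0 : ℝ) < a := by exact_mod_cast ha
      rcases hQ.lt_or_gt with h | h
      · rw [sign_neg (div_neg_of_neg_of_pos (by exact_mod_cast h) haR'), Int.sign_eq_neg_one_of_neg h]
        simp
      · rw [sign_pos (div_pos (by exact_mod_cast h) haR'), Int.sign_eq_one_of_pos h]
        simp
    rw [neg_I_mul_cpow_half hx, hsign, exp_neg, one_div, mul_inv, inv_inv, ← ofReal_inv,
      ← Real.sqrt_inv, ← abs_inv, inv_div] at key
    push_cast at key ⊢
    convert key using 3 with q _ m
    · congr 2
      ring
    · congr 1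
      field_simp
  · intro n
    refine exp_eq_exp_iff_exists_int.mpr ⟨n * Q + c * Q + z, ?_⟩
    push_cast
    field_simp
    linear_combination a * (2 * hzc + Q * hcc)
  · rcases Int.natAbs_eq Q with h | h
    · rw [← h]
      exact hperQ
    · rw [show ((Q.natAbs : ℕ) : ℤ) = -Q by omega]
      exact hperQ.neg
end

section
/- (Reciprocity formula for Gauss sums, matrix case.) Let Q be a nonsingular symmetric g×g matrix with integer coefficients, a a positive even integer, and w ∈ ℚ^g with a·w ∈ ℤ^g. Then Σ_{q ∈ (ℤ/aℤ)^g} exp((πi/a)·qᵀQq + 2πi wᵀq) = |a^g / det Q|^{1/2} · exp((πi/4)·sgn Q) · Σ_{m ∈ ℤ^g/Qℤ^g} exp(−πi a (m+w)ᵀ Q^{-1} (m+w)), where sgn Q denotes the signature of the quadratic form Q. -/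
open Complex

section Theta

open Filter Topology

/-- The theta series tends to `1` as the modulus tends to `i∞`, for a real elliptic variable. -/
lemma tendsto_jacobiTheta₂_ofReal {ι : Type*} {l : Filter ι} (x : ℝ) {τ : ι → ℂ}
    (hτ : Tendsto (fun t => (τ t).im) l atTop) :
    Tendsto (fun t => jacobiTheta₂ x (τ t)) l (𝓝 1) := by
  have hone : ∑' n : ℤ, (if n = 0 then (1 : ℂ) else 0) = 1 := tsum_ite_eq 0 _
  rw [← hone]
  refine tendsto_tsum_of_dominated_convergence
    (bound := fun n : ℤ => Real.exp (-Real.pi * (1 * n ^ 2 - 2 * 0 * |n|))) ?_ ?_ ?_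
  · simpa using summable_pow_mul_jacobiTheta₂_term_bound 0 one_pos 0
  · intro n
    rcases eq_or_ne n 0 with rfl | hn
    · simpa [jacobiTheta₂_term] using tendsto_const_nhds
    · rw [if_neg hn, tendsto_zero_iff_norm_tendsto_zero]
      simp_rw [norm_jacobiTheta₂_term, ofReal_im, mul_zero, sub_zero]
      refine Real.tendsto_exp_atBot.comp (hτ.const_mul_atTop_of_neg ?_)
      have : (0 : ℝ) < (n : ℝ) ^ 2 := by positivity
      nlinarith [Real.pi_pos]
  · filter_upwards [hτ.eventually_ge_atTop 1] with t ht n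
    exact norm_jacobiTheta₂_term_le one_pos (by simp) ht n

lemma tsum_int_eq_sum_tsum_residues {f : ℤ → ℂ} (hf : Summable f) (N : ℕ) [NeZero N] :
    ∑' n, f n = ∑ r : Fin N, ∑' k : ℤ, f (k * N + (r : ℕ)) := by
  have h1 : Summable (fun p : Fin N × ℤ => f (p.2 * N + (p.1 : ℕ))) :=
    hf.comp_injective (((Equiv.prodComm _ _).trans (Int.divModEquiv N).symm).injective)
  rw [← tsum_fintype (L := .unconditional _), ← h1.tsum_prod]
  exact (((Equiv.prodComm _ _).trans (Int.divModEquiv N).symm).tsum_eq f).symm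

lemma ofReal_mul_cpow_half {t : ℝ} (ht : 0 < t) {u : ℂ} (hu : u ≠ 0) :
    ((t : ℂ) * u) ^ (1 / 2 : ℂ) = (Real.sqrt t : ℂ) * u ^ (1 / 2 : ℂ) := by
  have ht' : (t : ℂ) ≠ 0 := ofReal_ne_zero.mpr ht.ne'
  rw [Real.sqrt_eq_rpow, ofReal_cpow ht.le, cpow_def_of_ne_zero (mul_ne_zero ht' hu),
    log_ofReal_mul ht hu, ofReal_log ht.le, add_mul, exp_add, ← cpow_def_of_ne_zero ht',
    ← cpow_def_of_ne_zero hu]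
  push_cast
  rfl

/-- Poisson summation for a complex Gaussian along an arithmetic progression. -/
lemma tsum_exp_gaussian_progression {s : ℂ} (hs : 0 < s.re) (N : ℕ) [NeZero N] (x : ℝ) :
    ∑' k : ℤ, cexp (-Real.pi * s * (k * N + x) ^ 2)
      = 1 / (N * s ^ (1 / 2 : ℂ)) * jacobiTheta₂ ((x / N : ℝ) : ℂ) (I / (N ^ 2 * s)) := by
  have hN : (N : ℂ) ≠ 0 := Nat.cast_ne_zero.mpr (NeZero.ne N)
  have hN' : (0 : ℝ) < N := Nat.cast_pos.mpr (NeZero.pos N)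
  have hs0 : s ≠ 0 := by rintro rfl; simp at hs
  have key := jacobiTheta₂_functional_equation (I * s * N * x) (I * s * N ^ 2)
  have e1 : -I * (I * s * N ^ 2) = ((N ^ 2 : ℝ) : ℂ) * s := by
    push_cast; linear_combination (-s * N ^ 2) * I_sq
  have e2 : I * s * N * x / (I * s * N ^ 2) = ((x / N : ℝ) : ℂ) := by
    push_cast; field_simp
  have e3 : -1 / (I * s * N ^ 2) = I / (N ^ 2 * s) := by
    field_simp; linear_combination - I_sq
  have e4 : -Real.pi * I * (I * s * N * x) ^ 2 / (I * s * N ^ 2) = Real.pi * s * x ^ 2 := by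
    field_simp; linear_combination -x ^ 2 * I_sq
  rw [e1, e2, e3, e4, ofReal_mul_cpow_half (by positivity) hs0, Real.sqrt_sq hN'.le] at key
  have h1 : ∀ k : ℤ, cexp (-Real.pi * s * (k * N + x) ^ 2)
      = cexp (-(Real.pi * s * x ^ 2)) * jacobiTheta₂_term k (I * s * N * x) (I * s * N ^ 2) := by
    intro k
    rw [jacobiTheta₂_term, ← exp_add]
    congr 1
    linear_combination (-(2 * Real.pi * k * s * N * x + Real.pi * k ^ 2 * s * N ^ 2)) * I_sq
  rw [tsum_congr h1, tsum_mul_left, ← jacobiTheta₂, key, exp_neg]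
  push_cast
  field_simp

lemma inv_cpow_half_neg_I_mul {α : ℝ} (hα : α ≠ 0) :
    1 / (-I * α) ^ (1 / 2 : ℂ) * (1 / (1 / (α * α : ℂ)) ^ (1 / 2 : ℂ))
      = (Real.sqrt |α| : ℂ) * cexp (Real.pi * I / 4 * (Real.sign α : ℝ)) := by
  have h1 : (1 / (α * α : ℂ)) ^ (1 / 2 : ℂ) = ((|α|⁻¹ : ℝ) : ℂ) := by
    have h := ofReal_mul_cpow_half (t := (|α| ^ 2)⁻¹) (by positivity) (u := 1) one_ne_zero
    rw [one_cpow, mul_one, mul_one, Real.sqrt_inv, Real.sqrt_sq (abs_nonneg α), sq_abs] at h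
    rw [← h]
    push_cast
    rw [sq, one_div]
  have hs : ((Real.sqrt |α| : ℝ) : ℂ) ≠ 0 :=
    ofReal_ne_zero.mpr (Real.sqrt_pos.mpr (abs_pos.mpr hα)).ne'
  have hss : ((Real.sqrt |α| : ℝ) : ℂ) * (Real.sqrt |α| : ℝ) = (|α| : ℝ) := by
    rw [← ofReal_mul, Real.mul_self_sqrt (abs_nonneg α)]
  have h2 : (-I * α) ^ (1 / 2 : ℂ)
      = (Real.sqrt |α| : ℂ) * cexp (-(Real.pi * I / 4 * (Real.sign α : ℝ))) := by
    rcases lt_or_gt_of_ne hα with h | h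
    · have e : -I * α = ((|α| : ℝ) : ℂ) * I := by rw [abs_of_neg h]; push_cast; ring
      rw [e, ofReal_mul_cpow_half (abs_pos.mpr hα) I_ne_zero, Real.sign_of_neg h,
        cpow_def_of_ne_zero I_ne_zero, log_I]
      congr 2
      push_cast
      ring
    · have e : -I * α = ((|α| : ℝ) : ℂ) * (-I) := by rw [abs_of_pos h]; ring
      rw [e, ofReal_mul_cpow_half (abs_pos.mpr hα) (neg_ne_zero.mpr I_ne_zero),
        Real.sign_of_pos h, cpow_def_of_ne_zero (neg_ne_zero.mpr I_ne_zero), log_neg_I]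
      congr 2
      push_cast
      ring
  rw [h1, h2, exp_neg, ofReal_inv, ← hss]
  field_simp

/-- Reciprocity for quadratic exponential sums in one variable, summed over a common period. -/
lemma sum_exp_quadratic_reciprocity {α β : ℝ} (hα : α ≠ 0) (N : ℕ) [NeZero N]
    (hF : ∀ n k : ℤ, cexp (Real.pi * I * (α * (k * N + n) ^ 2 + 2 * β * (k * N + n)))
      = cexp (Real.pi * I * (α * n ^ 2 + 2 * β * n)))
    (hG : ∀ n k : ℤ, cexp (-(Real.pi * I * ((k * N + n + β) ^ 2 / α)))
      = cexp (-(Real.pi * I * ((n + β) ^ 2 / α)))) :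
    ∑ r : Fin N, cexp (Real.pi * I * (α * (r : ℕ) ^ 2 + 2 * β * (r : ℕ)))
      = (Real.sqrt |α| : ℂ) * cexp (Real.pi * I / 4 * (Real.sign α : ℝ))
        * ∑ r : Fin N, cexp (-(Real.pi * I * (((r : ℕ) + β) ^ 2 / α))) := by
  have hN : (N : ℂ) ≠ 0 := Nat.cast_ne_zero.mpr (NeZero.ne N)
  have hN' : (0 : ℝ) < N := Nat.cast_pos.mpr (NeZero.pos N)
  have hαc : (α : ℂ) ≠ 0 := ofReal_ne_zero.mpr hα
  set F : ℤ → ℂ := fun n => cexp (Real.pi * I * (α * n ^ 2 + 2 * β * n)) with hFdef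
  set G : ℤ → ℂ := fun n => cexp (-(Real.pi * I * ((n + β) ^ 2 / α))) with hGdef
  set τ : ℝ → ℂ := fun ε => α + ε * I with hτdef
  set u : ℝ → ℂ := fun ε => 1 / (α * τ ε) with hudef
  have hτim : ∀ ε, (τ ε).im = ε := fun ε => by simp [hτdef]
  have hτ0 : ∀ ε, τ ε ≠ 0 := fun ε h => hα (by simpa [hτdef] using congrArg re h)
  have hu0 : ∀ ε, u ε ≠ 0 := fun ε => one_div_ne_zero (mul_ne_zero hαc (hτ0 ε))
  have hure : ∀ ε, 0 < (u ε).re := by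
    intro ε
    have : u ε = ((1 / (α ^ 2 + ε ^ 2) : ℝ) : ℂ) + ((-(ε / α) / (α ^ 2 + ε ^ 2) : ℝ) : ℂ) * I := by
      have h3 : (α : ℂ) ^ 2 + (ε : ℂ) ^ 2 ≠ 0 := by
        have : (0 : ℝ) < α ^ 2 + ε ^ 2 := by positivity
        exact_mod_cast this.ne'
      have h4 : (α : ℂ) + ε * I ≠ 0 := hτ0 ε
      simp only [hudef, hτdef]
      push_cast
      field_simp
      linear_combination (ε : ℂ) ^ 2 * I_sq
    rw [this]
    simp only [add_re, ofReal_re, re_ofReal_mul, I_re, mul_zero, add_zero]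
    positivity
  have hleft : ∀ ε, 0 < ε → jacobiTheta₂ β (τ ε) = 1 / (N * (Real.sqrt ε : ℂ)) *
      ∑ r : Fin N, F (r : ℕ) * jacobiTheta₂ (((r : ℕ) / N : ℝ) : ℂ) (I / (N ^ 2 * ε)) := by
    intro ε hε
    have hsum := (summable_jacobiTheta₂_term_iff β (τ ε)).mpr (by rw [hτim]; exact hε)
    rw [jacobiTheta₂, tsum_int_eq_sum_tsum_residues hsum N, Finset.mul_sum]
    refine Finset.sum_congr rfl fun r _ => ?_
    have h1 : ∀ k : ℤ, jacobiTheta₂_term (k * N + (r : ℕ)) β (τ ε)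
        = F (r : ℕ) * cexp (-Real.pi * (ε : ℂ) * (k * N + ((r : ℕ) : ℝ)) ^ 2) := by
      intro k
      have h2 : F (r : ℕ) = cexp (Real.pi * I * (α * (k * N + (r : ℕ)) ^ 2
          + 2 * β * (k * N + (r : ℕ)))) := by
        have := hF (r : ℕ) k
        push_cast at this
        rw [this]
        simp [hFdef]
      rw [h2, jacobiTheta₂_term, ← exp_add]
      congr 1
      simp only [hτdef]
      push_cast
      linear_combination (Real.pi * (k * N + (r : ℕ)) ^ 2 * ε) * I_sq
    have h5 : (ε : ℂ) ^ (1 / 2 : ℂ) = (Real.sqrt ε : ℂ) := by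
      simpa using ofReal_mul_cpow_half hε one_ne_zero
    rw [tsum_congr h1, tsum_mul_left, tsum_exp_gaussian_progression (by simpa using hε), h5]
    ring
  have hright : ∀ ε, 0 < ε → jacobiTheta₂ β (τ ε) = 1 / (-I * τ ε) ^ (1 / 2 : ℂ) *
      (1 / (N * ((Real.sqrt ε : ℂ) * (u ε) ^ (1 / 2 : ℂ))) *
      ∑ r : Fin N, G (r : ℕ) *
        jacobiTheta₂ ((((r : ℕ) + β) / N : ℝ) : ℂ) (I / (N ^ 2 * (ε * u ε)))) := by
    intro ε hε
    have him : 0 < (-1 / τ ε).im := by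
      rw [neg_div, neg_im, one_div, inv_im, hτim, neg_div, neg_neg]
      exact div_pos hε (normSq_pos.mpr (hτ0 ε))
    have hsum := (summable_jacobiTheta₂_term_iff (-(β / τ ε)) (-1 / τ ε)).mpr him
    rw [jacobiTheta₂_functional_equation, mul_assoc]
    congr 1
    rw [← jacobiTheta₂_neg_left, jacobiTheta₂, tsum_int_eq_sum_tsum_residues hsum N,
      Finset.mul_sum, Finset.mul_sum]
    refine Finset.sum_congr rfl fun r _ => ?_
    have h1 : ∀ k : ℤ, jacobiTheta₂_term (k * N + (r : ℕ)) (-(β / τ ε)) (-1 / τ ε)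
        = cexp (Real.pi * I * β ^ 2 / τ ε) * (G (r : ℕ) *
          cexp (-Real.pi * (ε * u ε) * (k * N + (((r : ℕ) + β : ℝ) : ℂ)) ^ 2)) := by
      intro k
      have h2 : G (r : ℕ) = cexp (-(Real.pi * I * ((k * N + (r : ℕ) + β) ^ 2 / α))) := by
        have := hG (r : ℕ) k
        push_cast at this
        rw [this]
        simp [hGdef]
      have h3 : ε * u ε = I / τ ε - I / α := by
        have h4 : (α : ℂ) + ε * I ≠ 0 := hτ0 ε
        simp only [hudef, hτdef]
        field_simp
        linear_combination (ε : ℂ) * I_sq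
      rw [h2, h3, jacobiTheta₂_term, ← exp_add, ← exp_add]
      congr 1
      have := hτ0 ε
      push_cast
      field_simp
      ring
    have h5 : (ε * u ε) ^ (1 / 2 : ℂ) = (Real.sqrt ε : ℂ) * (u ε) ^ (1 / 2 : ℂ) :=
      ofReal_mul_cpow_half hε (hu0 ε)
    have h6 : cexp (-Real.pi * I * β ^ 2 / τ ε) * cexp (Real.pi * I * β ^ 2 / τ ε) = 1 := by
      rw [← exp_add, ← exp_zero]
      congr 1
      ring
    rw [tsum_congr h1, tsum_mul_left, tsum_mul_left, ← mul_assoc, h6, one_mul,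
      tsum_exp_gaussian_progression (by rw [re_ofReal_mul]; exact mul_pos hε (hure ε)), h5]
    ring
  have heq : ∀ ε : ℝ, 0 < ε →
      ∑ r : Fin N, F (r : ℕ) * jacobiTheta₂ (((r : ℕ) / N : ℝ) : ℂ) (I / (N ^ 2 * ε))
      = 1 / (-I * τ ε) ^ (1 / 2 : ℂ) * (1 / (u ε) ^ (1 / 2 : ℂ)) *
        ∑ r : Fin N, G (r : ℕ) *
          jacobiTheta₂ ((((r : ℕ) + β) / N : ℝ) : ℂ) (I / (N ^ 2 * (ε * u ε))) := by
    intro ε hε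
    have h := (hleft ε hε).symm.trans (hright ε hε)
    have hs : ((Real.sqrt ε : ℝ) : ℂ) ≠ 0 := ofReal_ne_zero.mpr (Real.sqrt_pos.mpr hε).ne'
    have h7 := congrArg (fun x => (N * (Real.sqrt ε : ℂ)) * x) h
    simp only [← mul_assoc] at h7
    rw [mul_one_div_cancel (mul_ne_zero hN hs), one_mul] at h7
    rw [h7]
    field_simp
  have hinv : Tendsto (fun ε : ℝ => α ^ 2 / N ^ 2 * ε⁻¹) (𝓝[>] 0) atTop :=
    tendsto_inv_nhdsGT_zero.const_mul_atTop (by positivity)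
  have hinv' : Tendsto (fun ε : ℝ => 1 / (N : ℝ) ^ 2 * ε⁻¹) (𝓝[>] 0) atTop :=
    tendsto_inv_nhdsGT_zero.const_mul_atTop (by positivity)
  have hL : Tendsto (fun ε : ℝ => ∑ r : Fin N, F (r : ℕ) *
      jacobiTheta₂ (((r : ℕ) / N : ℝ) : ℂ) (I / (N ^ 2 * ε))) (𝓝[>] 0)
      (𝓝 (∑ r : Fin N, F (r : ℕ) * 1)) := by
    refine tendsto_finsetSum _ fun r _ => (tendsto_jacobiTheta₂_ofReal _ ?_).const_mul _
    refine hinv'.congr fun ε => ?_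
    have : I / ((N : ℂ) ^ 2 * ε) = ((1 / (N : ℝ) ^ 2 * ε⁻¹ : ℝ) : ℂ) * I := by
      push_cast
      rw [one_div, ← mul_inv]
      ring
    rw [this, im_ofReal_mul, I_im, mul_one]
  have hR : Tendsto (fun ε : ℝ => ∑ r : Fin N, G (r : ℕ) *
      jacobiTheta₂ ((((r : ℕ) + β) / N : ℝ) : ℂ) (I / (N ^ 2 * (ε * u ε)))) (𝓝[>] 0)
      (𝓝 (∑ r : Fin N, G (r : ℕ) * 1)) := by
    refine tendsto_finsetSum _ fun r _ => (tendsto_jacobiTheta₂_ofReal _ ?_).const_mul _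
    refine hinv.congr' ?_
    filter_upwards [self_mem_nhdsWithin] with ε (hε : 0 < ε)
    have hεc : (ε : ℂ) ≠ 0 := ofReal_ne_zero.mpr hε.ne'
    have : I / ((N : ℂ) ^ 2 * (ε * u ε))
        = ((α ^ 2 / N ^ 2 * ε⁻¹ : ℝ) : ℂ) * I + ((-α / N ^ 2 : ℝ) : ℂ) := by
      have h4 : (α : ℂ) + ε * I ≠ 0 := hτ0 ε
      simp only [hudef, hτdef]
      push_cast
      field_simp
      linear_combination (ε : ℂ) * I_sq
    rw [this, add_im, im_ofReal_mul, I_im, mul_one, ofReal_im, add_zero]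
  have hτt : Tendsto τ (𝓝[>] 0) (𝓝 α) := by
    have : Continuous τ := by fun_prop
    simpa [hτdef] using (this.tendsto 0).mono_left nhdsWithin_le_nhds
  have hut : Tendsto u (𝓝[>] 0) (𝓝 (1 / (α * α))) :=
    tendsto_const_nhds.div (hτt.const_mul (α : ℂ)) (mul_ne_zero hαc hαc)
  have hc1 : Tendsto (fun ε => (-I * τ ε) ^ (1 / 2 : ℂ)) (𝓝[>] 0) (𝓝 ((-I * α) ^ (1 / 2 : ℂ))) :=
    (continuousAt_cpow_const (Or.inr (by simpa using hα))).tendsto.comp (hτt.const_mul (-I))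
  have hc2 : Tendsto (fun ε => (u ε) ^ (1 / 2 : ℂ)) (𝓝[>] 0)
      (𝓝 ((1 / (α * α : ℂ)) ^ (1 / 2 : ℂ))) := by
    refine (continuousAt_cpow_const (Or.inl ?_)).tendsto.comp hut
    rw [← ofReal_mul, ← ofReal_one, ← ofReal_div, ofReal_re]
    exact one_div_pos.mpr (mul_self_pos.mpr hα)
  have hIα : -I * (α : ℂ) ≠ 0 := mul_ne_zero (neg_ne_zero.mpr I_ne_zero) hαc
  have hn1 : (-I * (α : ℂ)) ^ (1 / 2 : ℂ) ≠ 0 := by simp [cpow_eq_zero_iff, hαc]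
  have hn2 : (1 / (α * α : ℂ)) ^ (1 / 2 : ℂ) ≠ 0 := by simp [cpow_eq_zero_iff, hαc]
  have hlim := ((tendsto_const_nhds (x := (1 : ℂ)).div hc1 hn1).mul
    (tendsto_const_nhds (x := (1 : ℂ)).div hc2 hn2)).mul hR
  have hfin := tendsto_nhds_unique (hL.congr' (by
    filter_upwards [self_mem_nhdsWithin] with ε hε using heq ε hε)) hlim
  rw [inv_cpow_half_neg_I_mul hα] at hfin
  simpa [hFdef, hGdef] using hfin

end Theta

open Matrix

/-- The additive character `x ↦ exp (π i x)` on the rationals. -/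
noncomputable def piExp (x : ℚ) : ℂ := cexp (Real.pi * I * x)

lemma piExp_add (x y : ℚ) : piExp (x + y) = piExp x * piExp y := by
  simp only [piExp, ← exp_add]
  congr 1
  push_cast
  ring

lemma piExp_two_mul_int {x : ℚ} (hx : x ∈ (Int.castRingHom ℚ).range) : piExp (2 * x) = 1 := by
  obtain ⟨z, rfl⟩ := hx
  rw [piExp, exp_eq_one_iff]
  exact ⟨z, by push_cast [eq_intCast]; ring⟩

lemma piExp_eq_of_sub {x y z : ℚ} (hz : z ∈ (Int.castRingHom ℚ).range) (h : x = y + 2 * z) :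
    piExp x = piExp y := by
  rw [h, piExp_add, piExp_two_mul_int hz, mul_one]

lemma intCast_mem_range (z : ℤ) : (z : ℚ) ∈ (Int.castRingHom ℚ).range := ⟨z, rfl⟩

lemma natCast_mem_range (n : ℕ) : (n : ℚ) ∈ (Int.castRingHom ℚ).range := ⟨n, by simp⟩

lemma exists_common_denominator {ι : Type*} [Fintype ι] (f : ι → ℚ) :
    ∃ D : ℕ, 0 < D ∧ ∀ i, (D : ℚ) * f i ∈ (Int.castRingHom ℚ).range := by
  refine ⟨∏ i, (f i).den, Finset.prod_pos fun i _ => (f i).pos, fun i => ?_⟩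
  obtain ⟨c, hc⟩ := Finset.dvd_prod_of_mem (fun i => (f i).den) (Finset.mem_univ i)
  refine ⟨c * (f i).num, ?_⟩
  rw [hc]
  push_cast [eq_intCast]
  rw [← Rat.den_mul_eq_num (f i)]
  ring

lemma mul_mem_range_of_dvd {D N : ℕ} (h : D ∣ N) {x : ℚ}
    (hx : (D : ℚ) * x ∈ (Int.castRingHom ℚ).range) :
    (N : ℚ) * x ∈ (Int.castRingHom ℚ).range := by
  obtain ⟨c, rfl⟩ := h
  have := mul_mem (natCast_mem_range c) hx
  rwa [← mul_assoc, mul_comm (c : ℚ), ← Nat.cast_mul] at this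

/-- The factor contributed by one diagonal entry of a quadratic form. -/
noncomputable def gaussFactor (d : ℚ) : ℂ :=
  (Real.sqrt |(d : ℝ)| : ℂ) * cexp (Real.pi * I / 4 * (Real.sign (d : ℝ) : ℝ))

lemma exists_period_sum_piExp_reciprocity {α : ℚ} (hα : α ≠ 0) {D : ℕ} (hD : 0 < D) :
    ∃ N₀ : ℕ, 0 < N₀ ∧ ∀ N : ℕ, 0 < N → N₀ ∣ N → ∀ β : ℚ,
      (D : ℚ) * β ∈ (Int.castRingHom ℚ).range →
      ∑ r : Fin N, piExp (α * ((r : ℕ) : ℚ) ^ 2 + 2 * β * ((r : ℕ) : ℚ))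
        = gaussFactor α * ∑ r : Fin N, piExp (-((((r : ℕ) : ℚ) + β) ^ 2 / α)) := by
  obtain ⟨E, hE, hEα⟩ := exists_common_denominator ![α, α⁻¹]
  refine ⟨2 * (E * D), by positivity, fun N hN hdvd β hβ => ?_⟩
  have : NeZero N := ⟨hN.ne'⟩
  obtain ⟨M, rfl⟩ : E * D ∣ N := (Dvd.intro_left 2 rfl).trans hdvd
  have h2 : 2 ∣ E * D * M := (Dvd.intro _ rfl).trans hdvd
  obtain ⟨K, hK⟩ := h2
  set N := E * D * M with hNdef
  have hNα : (N : ℚ) * α ∈ (Int.castRingHom ℚ).range :=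
    mul_mem_range_of_dvd ⟨D * M, by rw [hNdef]; ring⟩ (hEα 0)
  have hNα' : (N : ℚ) * α⁻¹ ∈ (Int.castRingHom ℚ).range :=
    mul_mem_range_of_dvd ⟨D * M, by rw [hNdef]; ring⟩ (hEα 1)
  have hNβ : (N : ℚ) * β ∈ (Int.castRingHom ℚ).range :=
    mul_mem_range_of_dvd ⟨E * M, by rw [hNdef]; ring⟩ hβ
  have hNβα : (N : ℚ) * (β * α⁻¹) ∈ (Int.castRingHom ℚ).range := by
    have h1 : (E : ℚ) * α⁻¹ ∈ (Int.castRingHom ℚ).range := hEα 1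
    have := mul_mem (natCast_mem_range M) (mul_mem h1 hβ)
    convert this using 1
    rw [hNdef]
    push_cast
    ring
  have hKQ : (N : ℚ) = 2 * K := by exact_mod_cast hK
  have key := sum_exp_quadratic_reciprocity (α := (α : ℝ)) (β := (β : ℝ))
    (by exact_mod_cast hα) N ?_ ?_
  · convert key using 1
    · refine Finset.sum_congr rfl fun r _ => ?_
      rw [piExp]
      push_cast
      rfl
    · rw [gaussFactor]
      congr 1
      refine Finset.sum_congr rfl fun r _ => ?_
      rw [piExp]
      congr 1
      push_cast
      ring
  · intro n k
    have h := piExp_eq_of_sub (x := α * (k * N + n) ^ 2 + 2 * β * (k * N + n))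
      (y := α * n ^ 2 + 2 * β * n)
      (z := (N * α) * (k ^ 2 * K + k * n) + N * β * k)
      (add_mem (mul_mem hNα ⟨k ^ 2 * K + k * n, by simp⟩) (mul_mem hNβ (intCast_mem_range k)))
      (by linear_combination (α * k ^ 2 * N) * hKQ)
    simp only [piExp] at h
    push_cast at h ⊢
    exact h
  · intro n k
    have h := piExp_eq_of_sub (x := -((k * N + n + β) ^ 2 / α))
      (y := -((n + β) ^ 2 / α))
      (z := -((N * α⁻¹) * (k ^ 2 * K + k * n) + N * (β * α⁻¹) * k))
      (neg_mem (add_mem (mul_mem hNα' ⟨k ^ 2 * K + k * n, by simp⟩)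
        (mul_mem hNβα (intCast_mem_range k))))
      (by linear_combination (-α⁻¹ * k ^ 2 * N) * hKQ)
    simp only [piExp] at h
    push_cast at h ⊢
    rw [← mul_neg, ← mul_neg]
    exact h

/-- A function invariant under `N ℤ^g` has the same sum over the box `[0, N)^g` after any
unimodular affine change of variables. -/
lemma sum_box_affine {g N : ℕ} (hN : 0 < N) {E : Type*} [AddCommMonoid E] (F : (Fin g → ℤ) → E)
    (hF : ∀ n k : Fin g → ℤ, F (n + (N : ℤ) • k) = F n)
    {U V : Matrix (Fin g) (Fin g) ℤ} (hUV : U * V = 1) (t : Fin g → ℤ) :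
    ∑ n : Fin g → Fin N, F (U *ᵥ (fun i => ((n i : ℕ) : ℤ)) + t)
      = ∑ n : Fin g → Fin N, F (fun i => ((n i : ℕ) : ℤ)) := by
  have hN' : (0 : ℤ) < N := by exact_mod_cast hN
  let red : (Fin g → ℤ) → (Fin g → Fin N) := fun x i =>
    ⟨(x i % N).toNat, by have := Int.emod_lt_of_pos (x i) hN'; omega⟩
  have hred : ∀ x : Fin g → ℤ,
      x = (fun i => ((red x i : ℕ) : ℤ)) + (N : ℤ) • (fun i => x i / N) := by
    intro x
    ext i
    simp only [red, Pi.add_apply, Pi.smul_apply, smul_eq_mul,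
      Int.toNat_of_nonneg (Int.emod_nonneg (x i) hN'.ne'), Int.emod_add_mul_ediv]
  have hFred : ∀ x, F x = F (fun i => ((red x i : ℕ) : ℤ)) := by
    intro x
    conv_lhs => rw [hred x]
    exact hF _ _
  have hinj : Function.Injective
      (fun n : Fin g → Fin N => red (U *ᵥ (fun i => ((n i : ℕ) : ℤ)) + t)) := by
    intro n n' h
    have h1 := hred (U *ᵥ (fun i => ((n i : ℕ) : ℤ)) + t)
    have h2 := hred (U *ᵥ (fun i => ((n' i : ℕ) : ℤ)) + t)
    simp only at h
    rw [h] at h1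
    obtain ⟨k, hk⟩ : ∃ k : Fin g → ℤ, U *ᵥ (fun i => ((n i : ℕ) : ℤ))
        = U *ᵥ (fun i => ((n' i : ℕ) : ℤ)) + (N : ℤ) • k := by
      refine ⟨(fun i => (U *ᵥ (fun i => ((n i : ℕ) : ℤ)) + t) i / (N : ℤ))
        - (fun i => (U *ᵥ (fun i => ((n' i : ℕ) : ℤ)) + t) i / (N : ℤ)), ?_⟩
      linear_combination (norm := module) h1 - h2
    have h3 := congrArg (fun v => V *ᵥ v) hk
    simp only [mulVec_add, mulVec_mulVec, mul_eq_one_comm.mp hUV, one_mulVec, mulVec_smul] at h3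
    ext i
    have h4 := congrFun h3 i
    simp only [Pi.add_apply, Pi.smul_apply, smul_eq_mul] at h4
    have h5 := congrArg (· % (N : ℤ)) h4
    simp only [Int.add_mul_emod_self_left] at h5
    rw [Int.emod_eq_of_lt (by positivity) (by exact_mod_cast (n i).2),
      Int.emod_eq_of_lt (by positivity) (by exact_mod_cast (n' i).2)] at h5
    exact_mod_cast h5
  rw [← (Function.Injective.bijective_of_finite hinj).sum_comp
    (fun n : Fin g → Fin N => F (fun i => ((n i : ℕ) : ℤ)))]
  exact Finset.sum_congr rfl fun n _ => hFred _

/-- Averaging a function invariant under a finite-index sublattice `Λ` over a box whose side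
annihilates the quotient is the same as averaging over the quotient. -/
lemma card_mul_sum_box {g N : ℕ} (hN : 0 < N) (Λ : Submodule ℤ (Fin g → ℤ))
    [Fintype ((Fin g → ℤ) ⧸ Λ)] (hΛ : ∀ k : Fin g → ℤ, (N : ℤ) • k ∈ Λ)
    (F : (Fin g → ℤ) → ℂ) (hF : ∀ n, ∀ k ∈ Λ, F (n + k) = F n)
    (R : ((Fin g → ℤ) ⧸ Λ) → (Fin g → ℤ)) (hR : ∀ x, Submodule.Quotient.mk (R x) = x) :
    (Fintype.card ((Fin g → ℤ) ⧸ Λ) : ℂ) * ∑ n : Fin g → Fin N, F (fun i => ((n i : ℕ) : ℤ))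
      = (N : ℂ) ^ g * ∑ x, F (R x) := by
  classical
  have hFR : ∀ n, F n = F (R (Submodule.Quotient.mk n)) := by
    intro n
    have h := hF (R (Submodule.Quotient.mk n)) (n - R (Submodule.Quotient.mk n))
      ((Submodule.Quotient.eq Λ).mp (hR _).symm)
    rwa [add_sub_cancel] at h
  let c : ((Fin g → ℤ) ⧸ Λ) → ℂ := fun x => ∑ n : Fin g → Fin N,
    if (Submodule.Quotient.mk (fun i => ((n i : ℕ) : ℤ)) : (Fin g → ℤ) ⧸ Λ) = x then 1 else 0
  have hc : ∀ x, c x = c 0 := by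
    intro x
    have := sum_box_affine hN (fun n : Fin g → ℤ =>
      if (Submodule.Quotient.mk n : (Fin g → ℤ) ⧸ Λ) = x then (1 : ℂ) else 0) (fun n k => by
        have : (Submodule.Quotient.mk (n + (N : ℤ) • k) : (Fin g → ℤ) ⧸ Λ)
            = Submodule.Quotient.mk n := by
          rw [Submodule.Quotient.eq, add_sub_cancel_left]
          exact hΛ k
        simp only [this]) (mul_one (1 : Matrix (Fin g) (Fin g) ℤ)) (R x)
    simp only [one_mulVec, Submodule.Quotient.mk_add, hR, add_eq_right] at this
    exact this.symm
  have hsum : ∀ f : ((Fin g → ℤ) ⧸ Λ) → ℂ,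
      ∑ n : Fin g → Fin N, f (Submodule.Quotient.mk (fun i => ((n i : ℕ) : ℤ)))
        = c 0 * ∑ x, f x := by
    intro f
    rw [Finset.mul_sum]
    calc _ = ∑ n : Fin g → Fin N, ∑ x,
          (if (Submodule.Quotient.mk (fun i => ((n i : ℕ) : ℤ)) : (Fin g → ℤ) ⧸ Λ) = x
            then 1 else 0) * f x := by
          simp
      _ = ∑ x, c x * f x := by
          rw [Finset.sum_comm]
          simp only [c, Finset.sum_mul]
      _ = _ := by simp only [hc]
  have h1 := hsum (fun _ => 1)
  simp only [Finset.sum_const, Finset.card_univ, Fintype.card_pi, Fintype.card_fin,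
    Finset.prod_const, nsmul_eq_mul, mul_one, Nat.cast_pow] at h1
  rw [h1, Finset.sum_congr rfl fun n _ => hFR _, hsum (fun x => F (R x))]
  ring

lemma sum_real_sign {ι : Type*} [Fintype ι] (w : ι → ℝ) :
    ∑ i, Real.sign (w i) = ({i | 0 < w i}.ncard : ℝ) - ({i | w i < 0}.ncard : ℝ) := by
  classical
  have h1 : ∀ p : ι → Prop, (({i | p i} : Set ι).ncard : ℝ) = ∑ i, if p i then 1 else 0 := by
    intro p
    rw [Set.ncard_eq_toFinset_card', Finset.sum_boole, Set.toFinset_ofPred]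
  rw [h1, h1, ← Finset.sum_sub_distrib]
  refine Finset.sum_congr rfl fun i _ => ?_
  rcases lt_trichotomy (w i) 0 with h | h | h
  · simp [Real.sign_of_neg h, h, h.not_gt]
  · simp [h]
  · simp [Real.sign_of_pos h, h, h.not_gt]

/-- Sylvester's law of inertia, phrased through the signs of the eigenvalues. -/
lemma sum_sign_eigenvalues_eq {g : ℕ} {M : Matrix (Fin g) (Fin g) ℝ} (hM : M.IsHermitian)
    {P : Matrix (Fin g) (Fin g) ℝ} (hP : IsUnit P.det) {d : Fin g → ℝ}
    (h : ∀ x, (P *ᵥ x) ⬝ᵥ M *ᵥ (P *ᵥ x) = ∑ i, d i * (x i) ^ 2) :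
    ∑ i, Real.sign (hM.eigenvalues i) = ∑ i, Real.sign (d i) := by
  set U : Matrix (Fin g) (Fin g) ℝ := hM.eigenvectorUnitary.1 with hU
  have hUU : Uᵀ * U = 1 := by
    have := (Unitary.mem_iff.mp hM.eigenvectorUnitary.2).1
    rwa [star_eq_conjTranspose, conjTranspose_eq_transpose_of_trivial] at this
  have hspec : M = U * diagonal hM.eigenvalues * Uᵀ := by
    have := hM.spectral_theorem
    rw [Unitary.conjStarAlgAut_apply] at this
    rw [star_eq_conjTranspose, conjTranspose_eq_transpose_of_trivial] at this
    exact this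
  have hdet : IsUnit (Uᵀ * P).det := by
    rw [det_mul]
    exact (IsUnit.of_mul_eq_one _ (by rw [← det_mul, hUU, det_one])).mul hP
  have hequiv : QuadraticMap.Equivalent (QuadraticMap.weightedSumSquares ℝ d)
      (QuadraticMap.weightedSumSquares ℝ hM.eigenvalues) := by
    refine ⟨⟨Matrix.toLinearEquiv' (Uᵀ * P) (Matrix.invertibleOfIsUnitDet _ hdet), fun x => ?_⟩⟩
    have h1 : (QuadraticMap.weightedSumSquares ℝ d) x = (P *ᵥ x) ⬝ᵥ M *ᵥ (P *ᵥ x) := by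
      rw [h, QuadraticMap.weightedSumSquares_apply]
      exact Finset.sum_congr rfl fun i _ => by rw [smul_eq_mul, sq]
    have h2 : (P *ᵥ x) ⬝ᵥ M *ᵥ (P *ᵥ x)
        = ((Uᵀ * P) *ᵥ x) ⬝ᵥ diagonal hM.eigenvalues *ᵥ ((Uᵀ * P) *ᵥ x) := by
      conv_lhs => rw [hspec]
      rw [← mulVec_mulVec, ← mulVec_mulVec, ← mulVec_mulVec, dotProduct_mulVec (P *ᵥ x) U,
        ← mulVec_transpose]
    rw [h1, h2, QuadraticMap.weightedSumSquares_apply]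
    refine Finset.sum_congr rfl fun i _ => ?_
    rw [mulVec_diagonal, smul_eq_mul]
    change _ * (((Uᵀ * P) *ᵥ x) i * ((Uᵀ * P) *ᵥ x) i) = _
    ring
  rw [sum_real_sign, sum_real_sign, ← QuadraticForm.sigPos_of_equiv_weightedSumSquares hequiv,
    ← QuadraticForm.sigNeg_of_equiv_weightedSumSquares hequiv,
    QuadraticForm.sigPos_weightedSumSquares, QuadraticForm.sigNeg_weightedSumSquares]

lemma quad_add {n R : Type*} [Fintype n] [CommRing R] {A : Matrix n n R} (hA : A.IsSymm)
    (x y : n → R) :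
    (x + y) ⬝ᵥ A *ᵥ (x + y) = x ⬝ᵥ A *ᵥ x + 2 * (x ⬝ᵥ A *ᵥ y) + y ⬝ᵥ A *ᵥ y := by
  have h : y ⬝ᵥ A *ᵥ x = x ⬝ᵥ A *ᵥ y := by
    rw [dotProduct_mulVec, ← mulVec_transpose, hA.eq, dotProduct_comm]
  rw [mulVec_add, dotProduct_add, add_dotProduct, add_dotProduct, h]
  ring

lemma dotProduct_mem_range {n : Type*} [Fintype n] {x y : n → ℚ}
    (hx : ∀ i, x i ∈ (Int.castRingHom ℚ).range) (hy : ∀ i, y i ∈ (Int.castRingHom ℚ).range) :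
    x ⬝ᵥ y ∈ (Int.castRingHom ℚ).range :=
  sum_mem fun i _ => mul_mem (hx i) (hy i)

/-- Periodicity of a rational quadratic exponential on the integral lattice. -/
lemma piExp_quad_add_period {g N : ℕ} {A : Matrix (Fin g) (Fin g) ℚ} (hA : A.IsSymm)
    (hN : Even N) (hNA : ∀ i j, (N : ℚ) * A i j ∈ (Int.castRingHom ℚ).range) {v : Fin g → ℚ}
    (hv : ∀ i, (N : ℚ) * v i ∈ (Int.castRingHom ℚ).range) {x k : Fin g → ℚ}
    (hx : ∀ i, x i ∈ (Int.castRingHom ℚ).range) (hk : ∀ i, k i ∈ (Int.castRingHom ℚ).range) :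
    piExp ((x + (N : ℚ) • k) ⬝ᵥ A *ᵥ (x + (N : ℚ) • k) + 2 * (v ⬝ᵥ (x + (N : ℚ) • k)))
      = piExp (x ⬝ᵥ A *ᵥ x + 2 * (v ⬝ᵥ x)) := by
  obtain ⟨K, hK⟩ := hN
  have hNAk : ∀ i, ((N : ℚ) • A *ᵥ k) i ∈ (Int.castRingHom ℚ).range := fun i => by
    have : ((N : ℚ) • A *ᵥ k) i = (fun j => (N : ℚ) * A i j) ⬝ᵥ k := by
      simp [mulVec, dotProduct, Finset.mul_sum, mul_assoc]
    rw [this]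
    exact dotProduct_mem_range (hNA i) hk
  refine piExp_eq_of_sub (z := x ⬝ᵥ ((N : ℚ) • A *ᵥ k) + K * (k ⬝ᵥ ((N : ℚ) • A *ᵥ k))
    + ((N : ℚ) • v) ⬝ᵥ k) (add_mem (add_mem (dotProduct_mem_range hx hNAk)
      (mul_mem (natCast_mem_range K) (dotProduct_mem_range hk hNAk)))
      (dotProduct_mem_range hv hk)) ?_
  have hKQ : (N : ℚ) = K + K := by exact_mod_cast hK
  rw [quad_add hA]
  simp only [mulVec_smul, dotProduct_smul, smul_dotProduct, dotProduct_add, smul_eq_mul]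
  linear_combination (N * (k ⬝ᵥ A *ᵥ k)) * hKQ

/-- `A` and `B` satisfy quadratic reciprocity with constant `c`: over every sufficiently divisible
box, the exponential sum of `A` with linear term `w` equals `c` times the sum of `-B` shifted by
`w`, uniformly for `w` of bounded denominator. -/
def HasReciprocity {g : ℕ} (A B : Matrix (Fin g) (Fin g) ℚ) (c : ℂ) : Prop :=
  ∀ D : ℕ, 0 < D → ∃ N₀ : ℕ, 0 < N₀ ∧ ∀ N : ℕ, 0 < N → N₀ ∣ N → ∀ w : Fin g → ℚ,
    (∀ i, (D : ℚ) * w i ∈ (Int.castRingHom ℚ).range) →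
    ∑ n : Fin g → Fin N, piExp ((fun i => ((n i : ℕ) : ℚ)) ⬝ᵥ A *ᵥ (fun i => ((n i : ℕ) : ℚ))
        + 2 * (w ⬝ᵥ (fun i => ((n i : ℕ) : ℚ))))
      = c * ∑ n : Fin g → Fin N,
        piExp (-(((fun i => ((n i : ℕ) : ℚ)) + w) ⬝ᵥ B *ᵥ ((fun i => ((n i : ℕ) : ℚ)) + w)))

lemma HasReciprocity.of_unimodular {g : ℕ} {A B : Matrix (Fin g) (Fin g) ℚ} (hA : A.IsSymm)
    (hB : B.IsSymm) {U V : Matrix (Fin g) (Fin g) ℤ} (hUV : U * V = 1) {c : ℂ}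
    (h : HasReciprocity ((U.map (Int.cast : ℤ → ℚ))ᵀ * A * U.map (Int.cast : ℤ → ℚ))
      (V.map (Int.cast : ℤ → ℚ) * B * (V.map (Int.cast : ℤ → ℚ))ᵀ) c) :
    HasReciprocity A B c := by
  intro D hD
  obtain ⟨N₁, hN₁, hrec⟩ := h D hD
  obtain ⟨E, hE, hEAB⟩ := exists_common_denominator
    (fun p : (Fin g × Fin g) ⊕ (Fin g × Fin g) =>
      Sum.elim (fun q => A q.1 q.2) (fun q => B q.1 q.2) p)
  refine ⟨2 * (N₁ * E * D), by positivity, fun N hN hdvd w hw => ?_⟩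
  have heven : Even N := even_iff_two_dvd.mpr ((Dvd.intro _ rfl).trans hdvd)
  have hdvd' : N₁ * E * D ∣ N := (Dvd.intro_left _ rfl).trans hdvd
  have hED : E * D ∣ N := (Dvd.intro_left N₁ (by ring)).trans hdvd'
  have hNA : ∀ i j, (N : ℚ) * A i j ∈ (Int.castRingHom ℚ).range := fun i j =>
    mul_mem_range_of_dvd ((Dvd.intro _ rfl).trans hED) (hEAB (Sum.inl (i, j)))
  have hNB : ∀ i j, (N : ℚ) * B i j ∈ (Int.castRingHom ℚ).range := fun i j =>
    mul_mem_range_of_dvd ((Dvd.intro _ rfl).trans hED) (hEAB (Sum.inr (i, j)))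
  have hNw : ∀ i, (N : ℚ) * w i ∈ (Int.castRingHom ℚ).range := fun i =>
    mul_mem_range_of_dvd ((Dvd.intro_left _ rfl).trans hED) (hw i)
  have hNBw : ∀ i, (N : ℚ) * (B *ᵥ w) i ∈ (Int.castRingHom ℚ).range := fun i => by
    refine mul_mem_range_of_dvd hED ?_
    have : ((E * D : ℕ) : ℚ) * (B *ᵥ w) i
        = (fun j => (E : ℚ) * B i j) ⬝ᵥ (fun j => (D : ℚ) * w j) := by
      rw [mulVec, dotProduct, dotProduct, Finset.mul_sum]
      refine Finset.sum_congr rfl fun j _ => ?_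
      push_cast
      ring
    rw [this]
    exact dotProduct_mem_range (fun j => hEAB (Sum.inr (i, j))) hw
  set cast : (Fin g → ℤ) → (Fin g → ℚ) := fun n i => (n i : ℚ) with hcast
  have hcast_mem : ∀ n i, cast n i ∈ (Int.castRingHom ℚ).range := fun n i => intCast_mem_range _
  have hcast_per : ∀ n k : Fin g → ℤ, cast (n + (N : ℤ) • k) = cast n + (N : ℚ) • cast k := by
    intro n k
    ext i
    simp [hcast]
  have hcast_mul : ∀ (W : Matrix (Fin g) (Fin g) ℤ) (n : Fin g → ℤ),
      cast (W *ᵥ n) = W.map (Int.cast : ℤ → ℚ) *ᵥ cast n := by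
    intro W n
    ext i
    simp [hcast, mulVec, dotProduct]
  have hcast_nat : ∀ n : Fin g → Fin N,
      cast (fun i => ((n i : ℕ) : ℤ)) = fun i => ((n i : ℕ) : ℚ) := by
    intro n
    ext i
    simp [hcast]
  have hL := sum_box_affine hN
    (fun n => piExp (cast n ⬝ᵥ A *ᵥ cast n + 2 * (w ⬝ᵥ cast n)))
    (fun n k => by
      rw [hcast_per]
      exact piExp_quad_add_period hA heven hNA hNw (hcast_mem n) (hcast_mem k)) hUV 0
  have hR := sum_box_affine hN
    (fun n => piExp (-((cast n + w) ⬝ᵥ B *ᵥ (cast n + w))))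
    (fun n k => by
      have hsplit : ∀ x : Fin g → ℚ, -((x + w) ⬝ᵥ B *ᵥ (x + w))
          = (x ⬝ᵥ (-B) *ᵥ x + 2 * ((-(B *ᵥ w)) ⬝ᵥ x)) + -(w ⬝ᵥ B *ᵥ w) := by
        intro x
        rw [quad_add hB, neg_mulVec, dotProduct_neg, neg_dotProduct, dotProduct_comm (B *ᵥ w)]
        ring
      rw [hsplit, hsplit, piExp_add _ (-(w ⬝ᵥ B *ᵥ w)), piExp_add _ (-(w ⬝ᵥ B *ᵥ w)), hcast_per,
        piExp_quad_add_period hB.neg heven (fun i j => by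
          rw [neg_apply, mul_neg]; exact neg_mem (hNB i j)) (fun i => by
          rw [Pi.neg_apply, mul_neg]; exact neg_mem (hNBw i)) (hcast_mem n) (hcast_mem k)])
    (U := Vᵀ) (V := Uᵀ) (by rw [← transpose_mul, hUV, transpose_one]) 0
  simp only [add_zero, hcast_mul, hcast_nat] at hL hR
  rw [← hL, ← hR]
  have hVU : (V.map (Int.cast : ℤ → ℚ))ᵀ * (U.map (Int.cast : ℤ → ℚ))ᵀ = 1 := by
    rw [← transpose_mul, ← transpose_one]
    congr 1
    have := congrArg (Int.castRingHom ℚ).mapMatrix hUV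
    rw [map_mul, map_one] at this
    exact this
  have key := hrec N hN ((Dvd.intro (E * D) (by ring)).trans hdvd')
    ((U.map (Int.cast : ℤ → ℚ))ᵀ *ᵥ w) (fun i => by
      have : (D : ℚ) * ((U.map (Int.cast : ℤ → ℚ))ᵀ *ᵥ w) i
          = (fun j => (U j i : ℚ)) ⬝ᵥ (fun j => (D : ℚ) * w j) := by
        rw [mulVec, dotProduct, dotProduct, Finset.mul_sum]
        refine Finset.sum_congr rfl fun j _ => ?_
        simp only [transpose_apply, map_apply]
        ring
      rw [this]
      exact dotProduct_mem_range (fun j => intCast_mem_range _) hw)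
  convert key using 1
  · refine Finset.sum_congr rfl fun n _ => ?_
    rw [← mulVec_mulVec, ← mulVec_mulVec, dotProduct_mulVec _ (U.map _)ᵀ, vecMul_transpose,
      mulVec_transpose _ w, ← dotProduct_mulVec]
  · congr 1
    refine Finset.sum_congr rfl fun n _ => ?_
    have hx : (Vᵀ).map (Int.cast : ℤ → ℚ) *ᵥ (fun i => ((n i : ℕ) : ℚ)) + w
        = (V.map (Int.cast : ℤ → ℚ))ᵀ *ᵥ
          ((fun i => ((n i : ℕ) : ℚ)) + (U.map (Int.cast : ℤ → ℚ))ᵀ *ᵥ w) := by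
      rw [mulVec_add, mulVec_mulVec, hVU, one_mulVec, transpose_map]
    rw [hx, ← mulVec_mulVec, ← mulVec_mulVec, dotProduct_mulVec _ (V.map _), ← mulVec_transpose]

/-- The Schur complement of the upper left entry of a matrix. -/
def pivotComplement {g : ℕ} (A : Matrix (Fin (g + 1)) (Fin (g + 1)) ℚ) : Matrix (Fin g) (Fin g) ℚ :=
  of fun i j => A i.succ j.succ - A i.succ 0 * A 0 j.succ / A 0 0

lemma pivotComplement_isSymm {g : ℕ} {A : Matrix (Fin (g + 1)) (Fin (g + 1)) ℚ} (hA : A.IsSymm) :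
    (pivotComplement A).IsSymm := by
  ext i j
  simp only [transpose_apply, pivotComplement, of_apply]
  rw [hA.apply i.succ j.succ, hA.apply 0 i.succ, hA.apply 0 j.succ]
  ring

lemma quad_vecCons {g : ℕ} {A : Matrix (Fin (g + 1)) (Fin (g + 1)) ℚ} (hA : A.IsSymm)
    (h0 : A 0 0 ≠ 0) (r : ℚ) (x : Fin g → ℚ) :
    vecCons r x ⬝ᵥ A *ᵥ vecCons r x
      = A 0 0 * (r + (fun j => A 0 j.succ) ⬝ᵥ x / A 0 0) ^ 2 + x ⬝ᵥ pivotComplement A *ᵥ x := by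
  have hS : x ⬝ᵥ pivotComplement A *ᵥ x = x ⬝ᵥ A.submatrix Fin.succ Fin.succ *ᵥ x
      - ((fun j => A 0 j.succ) ⬝ᵥ x) ^ 2 / A 0 0 := by
    have : pivotComplement A = A.submatrix Fin.succ Fin.succ
        - (A 0 0)⁻¹ • vecMulVec (fun j => A 0 j.succ) (fun j => A 0 j.succ) := by
      ext i j
      simp only [pivotComplement, of_apply, Matrix.sub_apply, submatrix_apply, Matrix.smul_apply,
        vecMulVec_apply, smul_eq_mul]
      rw [hA.apply 0 i.succ]
      ring
    rw [this, sub_mulVec, smul_mulVec, vecMulVec_mulVec, dotProduct_sub, dotProduct_smul]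
    simp only [op_smul_eq_smul, dotProduct_smul, smul_eq_mul]
    rw [dotProduct_comm x (fun j => A 0 j.succ)]
    ring
  have hcons : vecCons r x ⬝ᵥ A *ᵥ vecCons r x = A 0 0 * r ^ 2
      + 2 * r * ((fun j => A 0 j.succ) ⬝ᵥ x) + x ⬝ᵥ A.submatrix Fin.succ Fin.succ *ᵥ x := by
    have hsum : ∑ i, x i * (A i.succ 0 * r) = r * ∑ i, A 0 i.succ * x i := by
      rw [Finset.mul_sum]
      exact Finset.sum_congr rfl fun i _ => by rw [hA.apply 0 i.succ]; ring
    simp only [dotProduct, mulVec, Fin.sum_univ_succ, cons_val_zero, cons_val_succ, mul_add,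
      Finset.sum_add_distrib, submatrix_apply]
    linear_combination hsum
  rw [hS, hcons]
  field_simp
  ring

lemma pivotComplement_mul {g : ℕ} {A B : Matrix (Fin (g + 1)) (Fin (g + 1)) ℚ} (hAB : A * B = 1)
    (h0 : A 0 0 ≠ 0) : pivotComplement A * B.submatrix Fin.succ Fin.succ = 1 := by
  ext i j
  have h1 := congrFun (congrFun hAB i.succ) j.succ
  have h2 := congrFun (congrFun hAB 0) j.succ
  rw [mul_apply, Fin.sum_univ_succ] at h1 h2
  rw [mul_apply]
  have h3 : (1 : Matrix (Fin (g + 1)) (Fin (g + 1)) ℚ) i.succ j.succ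
      = (1 : Matrix (Fin g) (Fin g) ℚ) i j := by
    simp [one_apply]
  rw [h3] at h1
  rw [one_apply_ne (Fin.succ_ne_zero j).symm] at h2
  rw [← h1]
  have : ∑ k, pivotComplement A i k * B.submatrix Fin.succ Fin.succ k j
      = ∑ k : Fin g, A i.succ k.succ * B k.succ j.succ
        - A i.succ 0 / A 0 0 * ∑ k : Fin g, A 0 k.succ * B k.succ j.succ := by
    rw [Finset.mul_sum, ← Finset.sum_sub_distrib]
    refine Finset.sum_congr rfl fun k _ => ?_
    simp only [pivotComplement, of_apply, submatrix_apply]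
    ring
  rw [this]
  field_simp
  linear_combination (-A i.succ 0) * h2

lemma quad_inverse_vecCons {g : ℕ} {A B : Matrix (Fin (g + 1)) (Fin (g + 1)) ℚ} (hA : A.IsSymm)
    (hAB : A * B = 1) (h0 : A 0 0 ≠ 0) (r : ℚ) (x : Fin g → ℚ) :
    vecCons r x ⬝ᵥ B *ᵥ vecCons r x
      = r ^ 2 / A 0 0 + (x - (r / A 0 0) • fun j => A 0 j.succ) ⬝ᵥ
        B.submatrix Fin.succ Fin.succ *ᵥ (x - (r / A 0 0) • fun j => A 0 j.succ) := by
  set z := B *ᵥ vecCons r x with hz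
  have hAz : A *ᵥ z = vecCons r x := by rw [hz, mulVec_mulVec, hAB, one_mulVec]
  obtain ⟨z0, z', hzz⟩ : ∃ z0 z', z = vecCons z0 z' := ⟨z 0, vecTail z, (cons_head_tail z).symm⟩
  have hr : A 0 0 * z0 + (fun j => A 0 j.succ) ⬝ᵥ z' = r := by
    have := congrFun hAz 0
    rw [hzz, mulVec, dotProduct, Fin.sum_univ_succ] at this
    simpa [dotProduct] using this
  have hx : x - (r / A 0 0) • (fun j => A 0 j.succ) = pivotComplement A *ᵥ z' := by
    ext i
    have h1 := congrFun hAz i.succ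
    rw [hzz, mulVec, dotProduct, Fin.sum_univ_succ] at h1
    simp only [cons_val_zero, cons_val_succ] at h1
    have h2 : (pivotComplement A *ᵥ z') i = ∑ k : Fin g, A i.succ k.succ * z' k
        - A i.succ 0 / A 0 0 * ((fun j => A 0 j.succ) ⬝ᵥ z') := by
      rw [mulVec, dotProduct, dotProduct, Finset.mul_sum, ← Finset.sum_sub_distrib]
      refine Finset.sum_congr rfl fun k _ => ?_
      simp only [pivotComplement, of_apply]
      ring
    rw [h2, Pi.sub_apply, Pi.smul_apply, smul_eq_mul, ← h1, ← hr, hA.apply 0 i.succ]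
    field_simp
    ring
  have hBz : B.submatrix Fin.succ Fin.succ *ᵥ (pivotComplement A *ᵥ z') = z' := by
    rw [mulVec_mulVec, mul_eq_one_comm.mp (pivotComplement_mul hAB h0), one_mulVec]
  rw [hx, hBz, dotProduct_comm _ z', ← hAz, dotProduct_comm, hzz, quad_vecCons hA h0, ← hr]
  field_simp

lemma HasReciprocity.of_pivot {g : ℕ} {A B : Matrix (Fin (g + 1)) (Fin (g + 1)) ℚ}
    (hA : A.IsSymm) (hAB : A * B = 1) (h0 : A 0 0 ≠ 0) {c : ℂ}
    (h : HasReciprocity (pivotComplement A) (B.submatrix Fin.succ Fin.succ) c) :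
    HasReciprocity A B (gaussFactor (A 0 0) * c) := by
  intro D hD
  obtain ⟨E, hE, hEA⟩ := exists_common_denominator
    (fun p : Fin g ⊕ Fin g => Sum.elim (fun j => A 0 j.succ) (fun j => A 0 j.succ / A 0 0) p)
  obtain ⟨N₁, hN₁, hrec₁⟩ := exists_period_sum_piExp_reciprocity h0 (D := D * E) (by positivity)
  obtain ⟨N₂, hN₂, hrec₂⟩ := h (D * E) (by positivity)
  refine ⟨N₁ * N₂, by positivity, fun N hN hdvd w hw => ?_⟩
  set a : Fin g → ℚ := fun j => A 0 j.succ with ha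
  have hsplit : ∀ F : (Fin (g + 1) → ℚ) → ℂ,
      ∑ n : Fin (g + 1) → Fin N, F (fun i => ((n i : ℕ) : ℚ))
        = ∑ r : Fin N, ∑ n : Fin g → Fin N, F (vecCons ((r : ℕ) : ℚ) fun i => ((n i : ℕ) : ℚ)) := by
    intro F
    rw [← Fintype.sum_prod_type', ← (Fin.consEquiv fun _ => Fin N).sum_comp]
    refine Finset.sum_congr rfl fun p _ => ?_
    congr 1
    ext i
    refine Fin.cases ?_ (fun j => ?_) i <;> simp [Fin.consEquiv]
  obtain ⟨w0, w', rfl⟩ : ∃ w0 w', w = vecCons w0 w' := ⟨w 0, vecTail w, (cons_head_tail w).symm⟩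
  rw [hsplit (fun x => piExp (x ⬝ᵥ A *ᵥ x + 2 * (vecCons w0 w' ⬝ᵥ x))),
    hsplit (fun x => piExp (-((x + vecCons w0 w') ⬝ᵥ B *ᵥ (x + vecCons w0 w')))), Finset.sum_comm]
  have hn : ∀ (n : Fin g → Fin N) i, ((n i : ℕ) : ℚ) ∈ (Int.castRingHom ℚ).range :=
    fun n i => natCast_mem_range _
  calc _ = ∑ n : Fin g → Fin N,
        piExp ((fun i => ((n i : ℕ) : ℚ)) ⬝ᵥ pivotComplement A *ᵥ (fun i => ((n i : ℕ) : ℚ))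
          + (a ⬝ᵥ fun i => ((n i : ℕ) : ℚ)) ^ 2 / A 0 0 + 2 * (w' ⬝ᵥ fun i => ((n i : ℕ) : ℚ))) *
        ∑ r : Fin N, piExp (A 0 0 * ((r : ℕ) : ℚ) ^ 2
          + 2 * ((a ⬝ᵥ fun i => ((n i : ℕ) : ℚ)) + w0) * ((r : ℕ) : ℚ)) := by
        refine Finset.sum_congr rfl fun n _ => ?_
        rw [Finset.mul_sum]
        refine Finset.sum_congr rfl fun r _ => ?_
        rw [← piExp_add, quad_vecCons hA h0, cons_dotProduct_cons]
        congr 1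
        field_simp
        ring
    _ = gaussFactor (A 0 0) * ∑ r : Fin N, piExp (-((((r : ℕ) : ℚ) + w0) ^ 2 / A 0 0)) *
        ∑ n : Fin g → Fin N, piExp (
          (fun i => ((n i : ℕ) : ℚ)) ⬝ᵥ pivotComplement A *ᵥ (fun i => ((n i : ℕ) : ℚ))
          + 2 * ((w' - ((((r : ℕ) : ℚ) + w0) / A 0 0) • a) ⬝ᵥ (fun i => ((n i : ℕ) : ℚ)))) := by
        simp only [Finset.mul_sum]
        rw [Finset.sum_comm (s := (Finset.univ : Finset (Fin N)))]
        refine Finset.sum_congr rfl fun n _ => ?_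
        rw [← Finset.mul_sum, hrec₁ N hN ((Dvd.intro _ rfl).trans hdvd), ← mul_assoc,
          mul_comm _ (gaussFactor _), mul_assoc, ← Finset.mul_sum, Finset.mul_sum]
        · congr 1
          refine Finset.sum_congr rfl fun r _ => ?_
          rw [← piExp_add, ← piExp_add, sub_dotProduct, smul_dotProduct, smul_eq_mul]
          congr 1
          field_simp
          ring
        · rw [mul_add]
          refine add_mem ?_ (mul_mem_range_of_dvd (Dvd.intro _ rfl) (hw 0))
          refine mul_mem_range_of_dvd (Dvd.intro_left _ rfl) (D := E) ?_
          rw [← smul_eq_mul, ← smul_dotProduct]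
          exact dotProduct_mem_range (fun j => hEA (Sum.inl j)) (hn n)
    _ = _ := by
        rw [mul_assoc]
        congr 1
        rw [Finset.mul_sum]
        refine Finset.sum_congr rfl fun r _ => ?_
        rw [hrec₂ N hN ((Dvd.intro_left _ rfl).trans hdvd), mul_left_comm, Finset.mul_sum]
        · congr 1
          refine Finset.sum_congr rfl fun n _ => ?_
          rw [← piExp_add, cons_add_cons, quad_inverse_vecCons hA hAB h0, add_sub_assoc, neg_add]
        · intro i
          have h1 : (E : ℚ) * (a i / A 0 0) ∈ (Int.castRingHom ℚ).range := hEA (Sum.inr i)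
          have h2 : (D : ℚ) * w' i ∈ (Int.castRingHom ℚ).range := hw i.succ
          have h3 : (D : ℚ) * w0 ∈ (Int.castRingHom ℚ).range := hw 0
          have := sub_mem (mul_mem (natCast_mem_range E) h2)
            (mul_mem h1 (add_mem (mul_mem (natCast_mem_range D) (natCast_mem_range (r : ℕ))) h3))
          convert this using 1
          simp only [Pi.sub_apply, Pi.smul_apply, smul_eq_mul]
          push_cast
          ring

lemma isSymm_of_mul_eq_one {n R : Type*} [Fintype n] [DecidableEq n] [CommRing R]
    {A B : Matrix n n R} (hA : A.IsSymm) (hAB : A * B = 1) : B.IsSymm := by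
  have h : Bᵀ * A = 1 := by
    rw [← hA.eq, ← transpose_mul, hAB, transpose_one]
  rw [IsSymm, ← mul_one Bᵀ, ← hAB, ← mul_assoc, h, one_mul]

lemma exists_unimodular_pivot {g : ℕ} {A : Matrix (Fin (g + 1)) (Fin (g + 1)) ℚ} (hA : A.IsSymm)
    (hdet : IsUnit A.det) : ∃ U V : Matrix (Fin (g + 1)) (Fin (g + 1)) ℤ, U * V = 1 ∧
      ((U.map (Int.cast : ℤ → ℚ))ᵀ * A * U.map (Int.cast : ℤ → ℚ)) 0 0 ≠ 0 := by
  by_cases h0 : A 0 0 = 0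
  · obtain ⟨j, hj⟩ : ∃ j, A 0 j ≠ 0 := by
      by_contra! hcon
      exact hdet.ne_zero (det_eq_zero_of_row_eq_zero 0 hcon)
    have hj0 : j ≠ 0 := fun h => hj (h ▸ h0)
    have hU : ∀ t : ℤ, (((transvection j 0 t).map (Int.cast : ℤ → ℚ))ᵀ * A
        * (transvection j 0 t).map (Int.cast : ℤ → ℚ)) 0 0 = 2 * t * A 0 j + t ^ 2 * A j j := by
      intro t
      have h1 : (transvection j 0 t).map (Int.cast : ℤ → ℚ) = transvection j 0 (t : ℚ) := by
        ext k l
        simp only [transvection, map_apply, Matrix.add_apply, one_apply, single_apply]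
        push_cast
        rfl
      have h2 : (transvection j 0 (t : ℚ))ᵀ = transvection 0 j (t : ℚ) := by
        simp [transvection]
      rw [h1, h2, mul_transvection_apply_same, transvection_mul_apply_same,
        transvection_mul_apply_same, h0, hA.apply 0 j]
      ring
    have hinv : ∀ t : ℤ, transvection j 0 t * transvection j 0 (-t) = 1 := fun t => by
      rw [transvection_mul_transvection_same (h := hj0), add_neg_cancel, transvection_zero]
    by_cases h1 : 2 * ((1 : ℤ) : ℚ) * A 0 j + ((1 : ℤ) : ℚ) ^ 2 * A j j = 0
    · refine ⟨_, _, hinv (-1), ?_⟩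
      rw [hU]
      intro h2
      push_cast at h1 h2
      exact hj (by linarith)
    · exact ⟨_, _, hinv 1, by rwa [hU]⟩
  · exact ⟨1, 1, one_mul 1, by simpa using h0⟩

/-- A nonsingular rational symmetric matrix can be diagonalised by a change of variables of
determinant `± 1` in such a way that quadratic reciprocity holds with the product of the constants
of the diagonal entries. -/
lemma exists_diagonal_hasReciprocity {g : ℕ} (A B : Matrix (Fin g) (Fin g) ℚ) (hA : A.IsSymm)
    (hAB : A * B = 1) : ∃ (P : Matrix (Fin g) (Fin g) ℚ) (d : Fin g → ℚ), P.det ^ 2 = 1 ∧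
      (∀ x, (P *ᵥ x) ⬝ᵥ A *ᵥ (P *ᵥ x) = ∑ i, d i * x i ^ 2) ∧
      HasReciprocity A B (∏ i, gaussFactor (d i)) := by
  induction g with
  | zero =>
    refine ⟨1, Fin.elim0, by simp, fun x => by simp, fun D hD =>
      ⟨1, one_pos, fun N _ _ w _ => by simp⟩⟩
  | succ g ih =>
    have hdet : IsUnit A.det := (isUnit_iff_isUnit_det A).mp (IsUnit.of_mul_eq_one _ hAB)
    obtain ⟨U, V, hUV, hpivot⟩ := exists_unimodular_pivot hA hdet
    have hUVQ : U.map (Int.cast : ℤ → ℚ) * V.map (Int.cast : ℤ → ℚ) = 1 := by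
      have := congrArg (Int.castRingHom ℚ).mapMatrix hUV
      rw [map_mul, map_one] at this
      exact this
    have hUdet : (U.map (Int.cast : ℤ → ℚ)).det ^ 2 = 1 := by
      have h1 : (U.map (Int.cast : ℤ → ℚ)).det = ((U.det : ℤ) : ℚ) :=
        ((Int.castRingHom ℚ).map_det U).symm
      have h2 : IsUnit U.det := (isUnit_iff_isUnit_det U).mp (IsUnit.of_mul_eq_one _ hUV)
      rw [h1, ← Int.cast_pow, sq, Int.isUnit_mul_self h2, Int.cast_one]
    set W := U.map (Int.cast : ℤ → ℚ) with hW
    set X := V.map (Int.cast : ℤ → ℚ) with hX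
    set A₁ := Wᵀ * A * W with hA₁
    have hA₁symm : A₁.IsSymm := by
      rw [IsSymm, hA₁, transpose_mul, transpose_mul, transpose_transpose, hA.eq, mul_assoc]
    have hAB₁ : A₁ * (X * B * Xᵀ) = 1 := by
      calc A₁ * (X * B * Xᵀ) = Wᵀ * (A * (W * X) * B) * Xᵀ := by simp only [hA₁, mul_assoc]
        _ = 1 := by
          rw [hUVQ, mul_one, hAB, mul_one, ← transpose_mul, mul_eq_one_comm.mp hUVQ, transpose_one]
    obtain ⟨P, d, hPdet, hPd, hrec⟩ := ih (pivotComplement A₁) _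
      (pivotComplement_isSymm hA₁symm) (pivotComplement_mul hAB₁ hpivot)
    set P₁ : Matrix (Fin (g + 1)) (Fin (g + 1)) ℚ := of (vecCons
      (vecCons 1 fun k => -((fun j => A₁ 0 j.succ) ⬝ᵥ fun i => P i k) / A₁ 0 0)
      fun i => vecCons 0 (P i)) with hP₁
    have hP₁mul : ∀ x : Fin (g + 1) → ℚ, P₁ *ᵥ x = vecCons
        (x 0 - (fun j => A₁ 0 j.succ) ⬝ᵥ (P *ᵥ vecTail x) / A₁ 0 0) (P *ᵥ vecTail x) := by
      intro x
      ext i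
      refine Fin.cases ?_ (fun i => ?_) i
      · rw [dotProduct_mulVec, mulVec, dotProduct, Fin.sum_univ_succ, sub_eq_add_neg, ← neg_div,
          cons_val_zero, dotProduct, ← Finset.sum_neg_distrib, Finset.sum_div]
        congr 1
        · simp [hP₁]
        · refine Finset.sum_congr rfl fun k _ => ?_
          simp only [hP₁, of_apply, cons_val_zero, cons_val_succ, vecMul, vecTail, Function.comp]
          ring
      · rw [mulVec, dotProduct, Fin.sum_univ_succ]
        simp [hP₁, mulVec, dotProduct, vecTail]
    have hP₁det : P₁.det = P.det := by
      rw [det_succ_column_zero, Fin.sum_univ_succ]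
      have : P₁.submatrix (Fin.succAbove 0) Fin.succ = P := by
        ext i j
        simp [hP₁]
      simp [hP₁]
      exact congrArg det this
    refine ⟨W * P₁, Fin.cons (A₁ 0 0) d, ?_, fun x => ?_, ?_⟩
    · rw [det_mul, mul_pow, hUdet, hP₁det, hPdet, one_mul]
    · have : ∀ y, (W *ᵥ y) ⬝ᵥ A *ᵥ (W *ᵥ y) = y ⬝ᵥ A₁ *ᵥ y := by
        intro y
        rw [hA₁, ← mulVec_mulVec, ← mulVec_mulVec, dotProduct_mulVec y, vecMul_transpose]
      rw [← mulVec_mulVec, this, hP₁mul, quad_vecCons hA₁symm hpivot, hPd, Fin.sum_univ_succ]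
      simp [vecTail]
    · rw [Fin.prod_univ_succ]
      exact HasReciprocity.of_unimodular hA (isSymm_of_mul_eq_one hA hAB) hUV
        (HasReciprocity.of_pivot hA₁symm hAB₁ hpivot hrec)

lemma IsSymm.eq_of_quad_eq {n R : Type*} [Fintype n] [DecidableEq n] [CommRing R] [NoZeroDivisors R]
    [NeZero (2 : R)] {M N : Matrix n n R} (hM : M.IsSymm) (hN : N.IsSymm)
    (h : ∀ x, x ⬝ᵥ M *ᵥ x = x ⬝ᵥ N *ᵥ x) : M = N := by
  ext i j
  have key := h (Pi.single i 1 + Pi.single j 1)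
  rw [quad_add hM, quad_add hN, h, h] at key
  have h2 : (2 : R) * M i j = 2 * N i j := by
    simpa using key
  exact mul_left_cancel₀ (NeZero.ne 2) h2

lemma transpose_mul_mul_eq_diagonal {n R : Type*} [Fintype n] [DecidableEq n] [CommRing R]
    [NoZeroDivisors R] [NeZero (2 : R)] {A P : Matrix n n R} {d : n → R} (hA : A.IsSymm)
    (h : ∀ x, (P *ᵥ x) ⬝ᵥ A *ᵥ (P *ᵥ x) = ∑ i, d i * x i ^ 2) : Pᵀ * A * P = diagonal d := by
  refine IsSymm.eq_of_quad_eq ?_ (isSymm_diagonal d) fun x => ?_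
  · rw [IsSymm, transpose_mul, transpose_mul, transpose_transpose, hA.eq, mul_assoc]
  · rw [← mulVec_mulVec, ← mulVec_mulVec, dotProduct_mulVec x, vecMul_transpose, h, dotProduct]
    refine Finset.sum_congr rfl fun i _ => ?_
    rw [mulVec_diagonal]
    ring

lemma det_eq_prod_of_transpose_mul_mul {n R : Type*} [Fintype n] [DecidableEq n] [CommRing R]
    {A P : Matrix n n R} {d : n → R} (hP : P.det ^ 2 = 1) (h : Pᵀ * A * P = diagonal d) :
    A.det = ∏ i, d i := by
  rw [← det_diagonal, ← h, det_mul, det_mul, det_transpose, mul_right_comm, ← sq, hP, one_mul]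

lemma prod_gaussFactor {ι : Type*} [Fintype ι] (d : ι → ℚ) :
    ∏ i, gaussFactor (d i) = (Real.sqrt |((∏ i, d i : ℚ) : ℝ)| : ℂ)
      * cexp (Real.pi * I / 4 * ((∑ i, Real.sign (d i : ℝ) : ℝ) : ℂ)) := by
  simp only [gaussFactor, Finset.prod_mul_distrib, ← exp_sum, ← Finset.mul_sum]
  push_cast
  congr 1
  rw [← ofReal_prod, Finset.abs_prod, Real.sqrt_prod _ fun i _ => abs_nonneg _]

lemma natCard_quotient_range_mulVecLin {g : ℕ} {Q : Matrix (Fin g) (Fin g) ℤ} (hQ : Q.det ≠ 0) :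
    Nat.card ((Fin g → ℤ) ⧸ LinearMap.range Q.mulVecLin) = Q.det.natAbs := by
  have hinj : Function.Injective Q.mulVecLin := mulVec_injective_of_det_ne_zero hQ
  rw [← Submodule.natAbs_det_equiv _ (LinearEquiv.ofInjective Q.mulVecLin hinj),
    ← LinearMap.det_toLin' Q]
  rfl

lemma smul_mem_range_mulVecLin_of_natAbs_det_dvd {g : ℕ} (Q : Matrix (Fin g) (Fin g) ℤ) {N : ℕ}
    (h : Q.det.natAbs ∣ N) (k : Fin g → ℤ) : (N : ℤ) • k ∈ LinearMap.range Q.mulVecLin := by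
  obtain ⟨c, hc⟩ := Int.natAbs_dvd.mp (Int.natCast_dvd_natCast.mpr h)
  refine ⟨Q.adjugate *ᵥ (c • k), ?_⟩
  rw [mulVecLin_apply, mulVec_mulVec, mul_adjugate, smul_mulVec, one_mulVec, hc, mul_smul]

lemma pow_mul_sum_box_of_dvd {g a N : ℕ} (ha : 0 < a) (hN : 0 < N) (h : a ∣ N)
    (F : (Fin g → ℤ) → ℂ) (hF : ∀ n k : Fin g → ℤ, F (n + (a : ℤ) • k) = F n) :
    (a : ℂ) ^ g * ∑ n : Fin g → Fin N, F (fun i => ((n i : ℕ) : ℤ))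
      = (N : ℂ) ^ g * ∑ n : Fin g → Fin a, F (fun i => ((n i : ℕ) : ℤ)) := by
  set Q : Matrix (Fin g) (Fin g) ℤ := (a : ℤ) • 1 with hQ
  have hQmul : ∀ k, Q *ᵥ k = (a : ℤ) • k := fun k => by rw [hQ, smul_mulVec, one_mulVec]
  have hdet : Q.det ≠ 0 := by
    rw [hQ, det_smul, det_one, mul_one]
    exact pow_ne_zero _ (by exact_mod_cast ha.ne')
  have hcard : Nat.card ((Fin g → ℤ) ⧸ LinearMap.range Q.mulVecLin) ≠ 0 := by
    rw [natCard_quotient_range_mulVecLin hdet]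
    exact Int.natAbs_ne_zero.mpr hdet
  have : Finite ((Fin g → ℤ) ⧸ LinearMap.range Q.mulVecLin) := Nat.finite_of_card_ne_zero hcard
  have : Fintype ((Fin g → ℤ) ⧸ LinearMap.range Q.mulVecLin) := Fintype.ofFinite _
  have hper : ∀ n, ∀ k ∈ LinearMap.range Q.mulVecLin, F (n + k) = F n := by
    rintro n _ ⟨k, rfl⟩
    rw [mulVecLin_apply, hQmul, hF]
  have hmem : ∀ M : ℕ, a ∣ M → ∀ k : Fin g → ℤ, (M : ℤ) • k ∈ LinearMap.range Q.mulVecLin := by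
    rintro _ ⟨c, rfl⟩ k
    refine ⟨(c : ℤ) • k, ?_⟩
    rw [mulVecLin_apply, hQmul, smul_smul, Nat.cast_mul]
  have hout : ∀ x : (Fin g → ℤ) ⧸ LinearMap.range Q.mulVecLin,
      Submodule.Quotient.mk (Quotient.out x) = x := fun x => Quotient.out_eq' x
  have h1 := card_mul_sum_box hN _ (hmem N h) F hper Quotient.out hout
  have h2 := card_mul_sum_box ha _ (hmem a dvd_rfl) F hper Quotient.out hout
  rw [Nat.card_eq_fintype_card] at hcard
  refine mul_left_cancel₀ (Nat.cast_ne_zero.mpr hcard : (_ : ℂ) ≠ 0) ?_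
  linear_combination (a : ℂ) ^ g * h1 - (N : ℂ) ^ g * h2

lemma sum_sign_eigenvalues_eq_of_quad {g : ℕ} {Q : Matrix (Fin g) (Fin g) ℤ}
    (hherm : (Q.map (Int.cast : ℤ → ℝ)).IsHermitian) {a : ℕ} (ha : 0 < a)
    {P : Matrix (Fin g) (Fin g) ℚ} {d : Fin g → ℚ} (hP : P.det ^ 2 = 1)
    (h : Pᵀ * ((a : ℚ)⁻¹ • Q.map (Int.cast : ℤ → ℚ)) * P = diagonal d) :
    ∑ i, Real.sign (hherm.eigenvalues i) = ∑ i, Real.sign (d i : ℝ) := by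
  have haR : (0 : ℝ) < a := by exact_mod_cast ha
  have hPu : IsUnit (P.map (Rat.castHom ℝ)).det := by
    have : (P.map (Rat.castHom ℝ)).det = Rat.castHom ℝ P.det := ((Rat.castHom ℝ).map_det P).symm
    rw [this]
    exact (IsUnit.of_mul_eq_one P.det (by rw [← sq, hP])).map _
  have hdiag : (P.map (Rat.castHom ℝ))ᵀ * Q.map (Int.cast : ℤ → ℝ) * P.map (Rat.castHom ℝ)
      = diagonal fun i => (a : ℝ) * d i := by
    have h' : Pᵀ * Q.map (Int.cast : ℤ → ℚ) * P = (a : ℚ) • diagonal d := by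
      rw [← h, Matrix.mul_smul, Matrix.smul_mul, smul_smul,
        mul_inv_cancel₀ (by exact_mod_cast ha.ne'), one_smul]
    have h2 := congrArg (Rat.castHom ℝ).mapMatrix h'
    rw [map_mul, map_mul] at h2
    convert h2 using 1
    · congr 2
    · ext i j
      by_cases hij : i = j <;> simp [hij]
  rw [sum_sign_eigenvalues_eq hherm hPu (d := fun i => (a : ℝ) * d i) fun x => ?_]
  · refine Finset.sum_congr rfl fun i _ => ?_
    rcases lt_trichotomy (d i : ℝ) 0 with hd | hd | hd
    · rw [Real.sign_of_neg hd, Real.sign_of_neg (mul_neg_of_pos_of_neg haR hd)]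
    · rw [hd, mul_zero]
    · rw [Real.sign_of_pos hd, Real.sign_of_pos (mul_pos haR hd)]
  · rw [dotProduct_comm, dotProduct_mulVec, ← mulVec_transpose, mulVec_mulVec, mulVec_mulVec,
      hdiag, dotProduct_comm, dotProduct]
    refine Finset.sum_congr rfl fun i _ => ?_
    rw [mulVec_diagonal]
    ring

lemma dotProduct_mulVec_eq_sum {n R : Type*} [Fintype n] [CommRing R] (M : Matrix n n R)
    (x : n → R) : x ⬝ᵥ M *ᵥ x = ∑ i, ∑ j, x i * M i j * x j := by
  simp only [dotProduct, mulVec, Finset.mul_sum, mul_assoc]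

lemma mul_sqrt_div_comm {u v : ℝ} (hu : 0 < u) (hv : 0 < v) : u * √(v / u) = v * √(u / v) := by
  have h : ∀ {s t : ℝ}, 0 < s → 0 < t → s * √(t / s) = √(s * t) := by
    intro s t hs ht
    rw [← Real.sqrt_sq hs.le, ← Real.sqrt_mul (sq_nonneg s), Real.sqrt_sq hs.le]
    congr 1
    field_simp
  rw [h hu hv, h hv hu, mul_comm]

/-- Matrix reciprocity formula for Gauss sums.  `Q` is a nonsingular
symmetric `g × g` integer matrix, `a` a positive even integer, `w ∈ ℚ^g` with `a·w ∈ ℤ^g`;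
the right-hand sum runs over the finite quotient `ℤ^g / Q ℤ^g`, represented via a
section `R`, and `sgn Q` is the signature of the quadratic form determined by `Q`. -/
theorem stmt_4 (g : ℕ) (Q : Matrix (Fin g) (Fin g) ℤ) (hQsymm : Q.IsSymm)
    (hQdet : Q.det ≠ 0)
    (hherm : (Q.map (Int.cast : ℤ → ℝ)).IsHermitian)
    (a : ℕ) (ha : 0 < a) (hae : Even a)
    (w : Fin g → ℚ) (hw : ∀ i, ∃ z : ℤ, (a : ℚ) * w i = (z : ℚ))
    (R : ((Fin g → ℤ) ⧸ LinearMap.range Q.mulVecLin) → (Fin g → ℤ))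
    (hR : ∀ x, Submodule.Quotient.mk (R x) = x)
    [Fintype ((Fin g → ℤ) ⧸ LinearMap.range Q.mulVecLin)] :
    ∑ q : Fin g → Fin a,
        Complex.exp ((Real.pi * Complex.I / (a : ℂ))
            * ∑ i, ∑ j, ((q i : ℕ) : ℂ) * (Q i j : ℂ) * ((q j : ℕ) : ℂ)
          + 2 * Real.pi * Complex.I * ∑ i, (w i : ℂ) * ((q i : ℕ) : ℂ))
      = (Real.sqrt |(a : ℝ) ^ g / (Q.det : ℝ)| : ℂ)
          * Complex.exp ((Real.pi * Complex.I / 4)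
              * ((∑ i, Real.sign (hherm.eigenvalues i) : ℝ) : ℂ))
          * ∑ m : ((Fin g → ℤ) ⧸ LinearMap.range Q.mulVecLin),
              Complex.exp (-(Real.pi : ℂ) * Complex.I * (a : ℂ)
                * ∑ i, ∑ j, ((R m i : ℂ) + (w i : ℂ))
                    * (((Q.map (Int.cast : ℤ → ℚ))⁻¹ i j : ℚ) : ℂ)
                    * ((R m j : ℂ) + (w j : ℂ))) := by
  have haQ : (a : ℚ) ≠ 0 := by exact_mod_cast ha.ne'
  have hw' : ∀ i, (a : ℚ) * w i ∈ (Int.castRingHom ℚ).range := fun i => by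
    obtain ⟨z, hz⟩ := hw i
    exact ⟨z, hz.symm⟩
  set T : Matrix (Fin g) (Fin g) ℚ := Q.map (Int.cast : ℤ → ℚ) with hT
  have hTsymm : T.IsSymm := hQsymm.map _
  have hTdet : T.det = (Q.det : ℚ) := ((Int.castRingHom ℚ).map_det Q).symm
  have hTunit : IsUnit T.det := by
    rw [hTdet]
    exact (Int.cast_ne_zero.mpr hQdet).isUnit
  have hTmul : ∀ k : Fin g → ℤ, T *ᵥ (fun i => (k i : ℚ)) = fun i => ((Q *ᵥ k) i : ℚ) := by
    intro k
    ext i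
    simp [hT, mulVec, dotProduct]
  set A : Matrix (Fin g) (Fin g) ℚ := (a : ℚ)⁻¹ • T with hA
  set B : Matrix (Fin g) (Fin g) ℚ := (a : ℚ) • T⁻¹ with hB
  have hAsymm : A.IsSymm := hTsymm.smul _
  have hAB : A * B = 1 := by
    rw [hA, hB, smul_mul_smul_comm, mul_nonsing_inv _ hTunit, inv_mul_cancel₀ haQ, one_smul]
  have hBsymm : B.IsSymm := isSymm_of_mul_eq_one hAsymm hAB
  have hBT : B * T = (a : ℚ) • 1 := by
    rw [hB, Matrix.smul_mul, nonsing_inv_mul _ hTunit]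
  obtain ⟨P, d, hP, hPd, hrec⟩ := exists_diagonal_hasReciprocity A B hAsymm hAB
  have hdiag := transpose_mul_mul_eq_diagonal hAsymm hPd
  obtain ⟨N₀, hN₀, hrecN⟩ := hrec a ha
  have hq : 0 < Q.det.natAbs := Int.natAbs_pos.mpr hQdet
  set N : ℕ := N₀ * a * Q.det.natAbs with hNdef
  have hN : 0 < N := by positivity
  have hsum := hrecN N hN ⟨a * Q.det.natAbs, by rw [hNdef, mul_assoc]⟩ w hw'
  let FL : (Fin g → ℤ) → ℂ := fun n =>
    piExp ((fun i => (n i : ℚ)) ⬝ᵥ A *ᵥ (fun i => (n i : ℚ)) + 2 * (w ⬝ᵥ fun i => (n i : ℚ)))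
  let FR : (Fin g → ℤ) → ℂ := fun n =>
    piExp (-(((fun i => (n i : ℚ)) + w) ⬝ᵥ B *ᵥ ((fun i => (n i : ℚ)) + w)))
  have hFL : ∀ n k : Fin g → ℤ, FL (n + (a : ℤ) • k) = FL n := by
    intro n k
    have hcast : (fun i => ((n + (a : ℤ) • k) i : ℚ))
        = (fun i => (n i : ℚ)) + (a : ℚ) • fun i => (k i : ℚ) := by
      ext i
      simp
    simp only [FL, hcast]
    refine piExp_quad_add_period hAsymm hae (fun i j => ?_) hw' (fun i => intCast_mem_range _)
      fun i => intCast_mem_range _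
    rw [hA, Matrix.smul_apply, smul_eq_mul, mul_inv_cancel_left₀ haQ]
    exact intCast_mem_range _
  have hFR : ∀ n, ∀ k ∈ LinearMap.range Q.mulVecLin, FR (n + k) = FR n := by
    rintro n _ ⟨k, rfl⟩
    obtain ⟨K, hK⟩ := hae
    have hKQ : (a : ℚ) = K + K := by exact_mod_cast hK
    have hcast : (fun i => ((n + Q.mulVecLin k) i : ℚ)) + w
        = ((fun i => (n i : ℚ)) + w) + T *ᵥ fun i => (k i : ℚ) := by
      rw [hTmul]
      ext i
      simp only [Pi.add_apply, mulVecLin_apply]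
      push_cast
      ring
    simp only [FR, hcast]
    have hk : ∀ i, (k i : ℚ) ∈ (Int.castRingHom ℚ).range := fun i => intCast_mem_range _
    refine piExp_eq_of_sub (z := -(a * ((fun i => (n i : ℚ)) ⬝ᵥ fun i => (k i : ℚ))
      + (fun i => a * w i) ⬝ᵥ (fun i => (k i : ℚ))
      + K * ((fun i => ((Q *ᵥ k) i : ℚ)) ⬝ᵥ fun i => (k i : ℚ))))
      (neg_mem (add_mem (add_mem (mul_mem (natCast_mem_range a)
        (dotProduct_mem_range (fun i => intCast_mem_range _) hk)) (dotProduct_mem_range hw' hk))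
        (mul_mem (natCast_mem_range K)
          (dotProduct_mem_range (fun i => intCast_mem_range _) hk)))) ?_
    have haw : (fun i => a * w i) = (a : ℚ) • w := rfl
    have hBTk : B *ᵥ (T *ᵥ fun i => (k i : ℚ)) = (a : ℚ) • fun i => (k i : ℚ) := by
      rw [mulVec_mulVec, hBT, smul_mulVec, one_mulVec]
    rw [quad_add hBsymm, hBTk, hTmul, haw]
    simp only [dotProduct_smul, smul_dotProduct, add_dotProduct, smul_eq_mul]
    linear_combination (-((fun i => ((Q *ᵥ k) i : ℚ)) ⬝ᵥ fun i => (k i : ℚ))) * hKQ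
  have hL := pow_mul_sum_box_of_dvd ha hN ⟨N₀ * Q.det.natAbs, by rw [hNdef]; ring⟩ FL hFL
  have hR' := card_mul_sum_box hN _
    (smul_mem_range_mulVecLin_of_natAbs_det_dvd Q (Dvd.intro_left _ rfl)) FR hFR R hR
  rw [← Nat.card_eq_fintype_card, natCard_quotient_range_mulVecLin hQdet] at hR'
  simp only [FL, FR, Int.cast_natCast] at hL hR'
  have hdet : ∏ i, d i = (Q.det : ℚ) / a ^ g := by
    rw [← det_eq_prod_of_transpose_mul_mul hP hdiag, hA, det_smul, Fintype.card_fin, hTdet, inv_pow,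
      div_eq_inv_mul]
  rw [prod_gaussFactor, hdet, ← sum_sign_eigenvalues_eq_of_quad hherm ha hP hdiag] at hsum
  have hterm_left : ∀ q : Fin g → Fin a,
      cexp ((Real.pi * I / (a : ℂ)) * ∑ i, ∑ j, ((q i : ℕ) : ℂ) * (Q i j : ℂ) * ((q j : ℕ) : ℂ)
        + 2 * Real.pi * I * ∑ i, (w i : ℂ) * ((q i : ℕ) : ℂ))
      = piExp ((fun i => ((q i : ℕ) : ℚ)) ⬝ᵥ A *ᵥ (fun i => ((q i : ℕ) : ℚ))
        + 2 * (w ⬝ᵥ fun i => ((q i : ℕ) : ℚ))) := by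
    intro q
    rw [piExp, hA, smul_mulVec, dotProduct_smul, dotProduct_mulVec_eq_sum, dotProduct, smul_eq_mul]
    congr 1
    simp only [hT, map_apply]
    push_cast
    ring
  have hterm_right : ∀ m : Fin g → ℤ,
      cexp (-(Real.pi : ℂ) * I * (a : ℂ) * ∑ i, ∑ j, ((m i : ℂ) + (w i : ℂ))
        * ((T⁻¹ i j : ℚ) : ℂ) * ((m j : ℂ) + (w j : ℂ)))
      = piExp (-(((fun i => (m i : ℚ)) + w) ⬝ᵥ B *ᵥ ((fun i => (m i : ℚ)) + w))) := by
    intro m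
    rw [piExp, hB, smul_mulVec, dotProduct_smul, dotProduct_mulVec_eq_sum, smul_eq_mul]
    congr 1
    simp only [Pi.add_apply]
    push_cast
    ring
  simp only [hterm_left, hterm_right]
  have hNC : (N : ℂ) ^ g ≠ 0 := pow_ne_zero _ (by exact_mod_cast hN.ne')
  have hqC : (Q.det.natAbs : ℂ) ≠ 0 := by exact_mod_cast hq.ne'
  have hsqrt : (a : ℂ) ^ g * (Real.sqrt |(((Q.det : ℚ) / a ^ g : ℚ) : ℝ)| : ℂ)
      = Q.det.natAbs * (Real.sqrt |(a : ℝ) ^ g / (Q.det : ℝ)| : ℂ) := by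
    have hu : (0 : ℝ) < (a : ℝ) ^ g := by positivity
    have hv : (0 : ℝ) < |(Q.det : ℝ)| := abs_pos.mpr (by exact_mod_cast hQdet)
    have := mul_sqrt_div_comm hu hv
    push_cast
    rw [abs_div, abs_div, abs_of_pos hu]
    have hcast : ((Q.det.natAbs : ℕ) : ℂ) = ((|(Q.det : ℝ)| : ℝ) : ℂ) := by
      rw [← Int.cast_abs, ofReal_intCast, Int.abs_eq_natAbs, Int.cast_natCast]
    rw [hcast]
    exact_mod_cast this
  refine mul_left_cancel₀ (mul_ne_zero hqC hNC) ?_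
  rw [mul_assoc, ← hL, hsum]
  linear_combination (a : ℂ) ^ g * (Real.sqrt |(((Q.det : ℚ) / a ^ g : ℚ) : ℝ)| : ℂ) *
    cexp (Real.pi * I / 4 * ((∑ i, Real.sign (hherm.eigenvalues i) : ℝ) : ℂ)) * hR'
    + cexp (Real.pi * I / 4 * ((∑ i, Real.sign (hherm.eigenvalues i) : ℝ) : ℂ)) * (N : ℂ) ^ g
      * (∑ m, piExp (-(((fun i => (R m i : ℚ)) + w) ⬝ᵥ B *ᵥ ((fun i => (R m i : ℚ)) + w)))) * hsqrt
end

section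
/- The Maslov-Kashiwara index satisfies the cocycle identity: for any four Lagrangian subspaces L₁, L₂, L₃, L₄ of a symplectic vector space (V,ω), τ(L₁, L₂, L₃) − τ(L₁, L₂, L₄) + τ(L₁, L₃, L₄) − τ(L₂, L₃, L₄) = 0. -/
/-- The maximal dimension of a subspace on which the quadratic map `q` is positive. -/
noncomputable def posIdx {W : Type*} [AddCommGroup W] [Module ℝ W] (q : W → ℝ) : ℕ :=
  sSup {n : ℕ | ∃ U : Submodule ℝ W, Module.finrank ℝ U = n ∧
    ∀ x : W, x ∈ U → x ≠ 0 → 0 < q x}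

/-- The signature (positive index minus negative index) of a quadratic map `q`. -/
noncomputable def qSignature {W : Type*} [AddCommGroup W] [Module ℝ W] (q : W → ℝ) : ℤ :=
  (posIdx q : ℤ) - (posIdx (fun x => -q x) : ℤ)

/-- The Maslov-Kashiwara index of a triple of (Lagrangian) subspaces: the signature of
the quadratic form `G(x₁⊕x₂⊕x₃) = ω(x₁,x₂) + ω(x₂,x₃) + ω(x₃,x₁)` on `L₁ ⊕ L₂ ⊕ L₃`. -/
noncomputable def maslovIndex {V : Type*} [AddCommGroup V] [Module ℝ V]
    (ω : V →ₗ[ℝ] V →ₗ[ℝ] ℝ) (L₁ L₂ L₃ : Submodule ℝ V) : ℤ :=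
  qSignature (fun x : ↥L₁ × ↥L₂ × ↥L₃ =>
    ω (x.1 : V) (x.2.1 : V) + ω (x.2.1 : V) (x.2.2 : V) + ω (x.2.2 : V) (x.1 : V))

/-- A Lagrangian subspace: isotropic of half the dimension of `V`. -/
def IsLagrangianSub {V : Type*} [AddCommGroup V] [Module ℝ V]
    (ω : V →ₗ[ℝ] V →ₗ[ℝ] ℝ) (L : Submodule ℝ V) : Prop :=
  (∀ x ∈ L, ∀ y ∈ L, ω x y = 0) ∧ 2 * Module.finrank ℝ L = Module.finrank ℝ V

namespace QuadraticForm

/-- The signature of a real quadratic form, as an integer. -/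
noncomputable def signature {M : Type*} [AddCommGroup M] [Module ℝ M]
    (Q : QuadraticForm ℝ M) : ℤ :=
  (sigPos Q : ℤ) - (sigNeg Q : ℤ)

lemma signature_neg {M : Type*} [AddCommGroup M] [Module ℝ M] (Q : QuadraticForm ℝ M) :
    signature (-Q) = -signature Q := by
  simp [signature]

lemma mem_radical_iff_polar {M : Type*} [AddCommGroup M] [Module ℝ M]
    (Q : QuadraticForm ℝ M) {x : M} :
    x ∈ Q.radical ↔ ∀ y, QuadraticMap.polar Q x y = 0 := by
  have : Invertible (2 : ℝ) := invertibleOfNonzero two_ne_zero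
  rw [QuadraticMap.radical_eq_ker_polarBilin, LinearMap.mem_ker, LinearMap.ext_iff]
  rfl

section

variable {M N : Type*} [AddCommGroup M] [Module ℝ M] [FiniteDimensional ℝ M]
  [AddCommGroup N] [Module ℝ N] [FiniteDimensional ℝ N]

lemma sigPos_comp_le (Q : QuadraticForm ℝ M) (f : N →ₗ[ℝ] M) :
    sigPos (Q.comp f) ≤ sigPos Q := by
  obtain ⟨P, hP, hpos⟩ := exists_finrank_eq_sigPos_and_posDef (Q.comp f)
  have hpos' : ∀ x ∈ P, x ≠ 0 → 0 < Q (f x) := fun x hx h0 =>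
    hpos ⟨x, hx⟩ (by simpa using h0)
  have hinj : Function.Injective (f.domRestrict P) := by
    rw [← LinearMap.ker_eq_bot, LinearMap.ker_eq_bot']
    intro x hx
    by_contra h
    have := hpos' x x.2 (by simpa using h)
    rw [show f x = 0 from hx] at this
    simp at this
  have hfin : Module.finrank ℝ (P.map f) = Module.finrank ℝ P := by
    rw [← LinearMap.range_domRestrict]
    exact LinearMap.finrank_range_of_inj hinj
  rw [← hP, ← hfin]
  apply le_sigPos_of_posDef
  rintro ⟨_, x, hx, rfl⟩ h0
  exact hpos' x hx (by rintro rfl; simp at h0)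

lemma signature_comp_of_surjective (Q : QuadraticForm ℝ M) (f : N →ₗ[ℝ] M)
    (hf : Function.Surjective f) : signature (Q.comp f) = signature Q := by
  obtain ⟨s, hs⟩ := f.exists_rightInverse_of_surjective (LinearMap.range_eq_top.2 hf)
  have key : ∀ R : QuadraticForm ℝ M, sigPos (R.comp f) = sigPos R := fun R => by
    refine le_antisymm (sigPos_comp_le R f) ?_
    have h := sigPos_comp_le (R.comp f) s
    rwa [show (R.comp f).comp s = R from
      QuadraticMap.ext fun x => congrArg R (LinearMap.congr_fun hs x)] at h
  have hneg : sigNeg (Q.comp f) = sigNeg Q := key (-Q)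
  rw [signature, signature, key, hneg]

lemma sigPos_add_finrank_le (Q : QuadraticForm ℝ M) (J : Submodule ℝ M) :
    sigPos Q + Module.finrank ℝ J ≤ sigPos (Q.restrict J) + Module.finrank ℝ M := by
  obtain ⟨P, hP, hpos⟩ := exists_finrank_eq_sigPos_and_posDef Q
  have h1 : Module.finrank ℝ (P.comap J.subtype) ≤ sigPos (Q.restrict J) := by
    apply le_sigPos_of_posDef
    intro x hx
    exact hpos ⟨_, x.2⟩ (fun h => hx (by ext; simpa using congrArg Subtype.val h))
  have h2 : Module.finrank ℝ (P.comap J.subtype) = Module.finrank ℝ (J ⊓ P : Submodule ℝ M) := by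
    rw [← Submodule.map_comap_subtype, Submodule.finrank_map_subtype_eq]
  have h3 := Submodule.finrank_sup_add_finrank_inf_eq J P
  have h4 := (J ⊔ P).finrank_le
  omega

/-- Restricting a form to the orthogonal of a totally isotropic subspace preserves
the signature. -/
lemma signature_restrict_orthogonal (Q : QuadraticForm ℝ M) (I : Submodule ℝ M)
    (hI : ∀ x ∈ I, Q x = 0) :
    signature (Q.restrict (LinearMap.BilinForm.orthogonal Q.polarBilin I)) = signature Q := by
  have : Invertible (2 : ℝ) := invertibleOfNonzero two_ne_zero
  set J := LinearMap.BilinForm.orthogonal Q.polarBilin I with hJ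
  have hmem : ∀ x, x ∈ J ↔ ∀ i ∈ I, QuadraticMap.polar Q i x = 0 := fun x =>
    LinearMap.BilinForm.mem_orthogonal_iff
  have hIJ : I ≤ J := fun x hx => (hmem x).2 fun i hi => by
    simp [QuadraticMap.polar, hI _ hi, hI _ hx, hI _ (I.add_mem hi hx)]
  have hRJ : Q.radical ≤ J := fun x hx => (hmem x).2 fun i _ => by
    rw [QuadraticMap.polar_comm]
    exact (mem_radical_iff_polar Q).1 hx i
  have hd : Module.finrank ℝ I + Module.finrank ℝ J =
      Module.finrank ℝ M + Module.finrank ℝ (I ⊓ Q.radical : Submodule ℝ M) := by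
    rw [QuadraticMap.radical_eq_ker_polarBilin]
    exact LinearMap.BilinForm.finrank_add_finrank_orthogonal' (B := Q.polarBilin) I
  have hsub : (I ⊔ Q.radical).comap J.subtype ≤ (Q.restrict J).radical := by
    intro x hx
    obtain ⟨i, hi, r, hr, hir⟩ := Submodule.mem_sup.1 (Submodule.mem_comap.1 hx)
    rw [mem_radical_iff_polar]
    intro y
    change QuadraticMap.polar Q (x : M) y = 0
    rw [← J.subtype_apply x, ← hir, QuadraticMap.polar_add_left, (hmem y).1 y.2 i hi,
      (mem_radical_iff_polar Q).1 hr, add_zero]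
  have hrad := Submodule.finrank_mono hsub
  rw [← Submodule.finrank_map_subtype_eq J ((I ⊔ Q.radical).comap J.subtype),
    Submodule.map_comap_subtype, inf_eq_right.2 (sup_le hIJ hRJ)] at hrad
  have hsup := Submodule.finrank_sup_add_finrank_inf_eq I Q.radical
  have hp := sigPos_add_finrank_le Q J
  have hn : sigNeg Q + _ ≤ sigNeg (Q.restrict J) + _ := sigPos_add_finrank_le (-Q) J
  have e1 := sigPos_add_sigNeg_add_radical (Q := Q)
  have e2 := sigPos_add_sigNeg_add_radical (Q := Q.restrict J)
  rw [signature, signature]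
  omega

/-- A form pulled back along a map onto the orthogonal of a totally isotropic subspace
has the same signature. -/
lemma signature_eq_of_range_eq_orthogonal (Q : QuadraticForm ℝ M) (Q' : QuadraticForm ℝ N)
    (f : N →ₗ[ℝ] M) (hf : ∀ y, Q (f y) = Q' y) (I : Submodule ℝ M) (hI : ∀ x ∈ I, Q x = 0)
    (hfI : ∀ y, ∀ i ∈ I, QuadraticMap.polar Q i (f y) = 0)
    (hIf : ∀ x, (∀ i ∈ I, QuadraticMap.polar Q i x = 0) → ∃ y, f y = x) :
    signature Q' = signature Q := by
  rw [← signature_restrict_orthogonal Q I hI]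
  set J := LinearMap.BilinForm.orthogonal Q.polarBilin I with hJ
  have hfJ : ∀ y, f y ∈ J := fun y => LinearMap.BilinForm.mem_orthogonal_iff.2 (hfI y)
  rw [← signature_comp_of_surjective (Q.restrict J) (f.codRestrict J hfJ)]
  · congr 1
    ext y
    exact (hf y).symm
  · rintro ⟨x, hx⟩
    obtain ⟨y, hy⟩ := hIf x (LinearMap.BilinForm.mem_orthogonal_iff.1 hx)
    exact ⟨y, Subtype.ext hy⟩

lemma finrank_submodule_prod (P : Submodule ℝ M) (P' : Submodule ℝ N) :
    Module.finrank ℝ (P.prod P') = Module.finrank ℝ P + Module.finrank ℝ P' := by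
  rw [← Module.finrank_prod, ← LinearMap.finrank_range_of_inj (f := P.subtype.prodMap P'.subtype)
    (Prod.map_injective.2 ⟨P.subtype_injective, P'.subtype_injective⟩), LinearMap.range_prodMap,
    P.range_subtype, P'.range_subtype]

lemma sigPos_add_le_sigPos_prod (Q : QuadraticForm ℝ M) (R : QuadraticForm ℝ N) :
    sigPos Q + sigPos R ≤ sigPos (QuadraticMap.prod Q R) := by
  obtain ⟨P, hP, hpos⟩ := exists_finrank_eq_sigPos_and_posDef Q
  obtain ⟨P', hP', hpos'⟩ := exists_finrank_eq_sigPos_and_posDef R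
  have h : Module.finrank ℝ (P.prod P') = sigPos Q + sigPos R := by
    rw [finrank_submodule_prod, hP, hP']
  rw [← h]
  apply le_sigPos_of_posDef
  rintro ⟨⟨x, y⟩, hx, hy⟩ h0
  exact (hpos.prod hpos') (⟨x, hx⟩, ⟨y, hy⟩) (fun h => h0 (by
    rw [Prod.ext_iff] at h
    ext
    · exact congrArg Subtype.val h.1
    · exact congrArg Subtype.val h.2))

lemma signature_prod (Q : QuadraticForm ℝ M) (R : QuadraticForm ℝ N) :
    signature (QuadraticMap.prod Q R) = signature Q + signature R := by
  have hp := sigPos_add_le_sigPos_prod Q R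
  have hn : sigNeg Q + sigNeg R ≤ sigNeg (QuadraticMap.prod Q R) := by
    have h := sigPos_add_le_sigPos_prod (-Q) (-R)
    rwa [show QuadraticMap.prod (-Q) (-R) = -QuadraticMap.prod Q R by
      ext x; simp [add_comm]] at h
  have hr : Q.radical.prod R.radical ≤ (QuadraticMap.prod Q R).radical := by
    rintro ⟨x, y⟩ ⟨hx, hy⟩
    rw [mem_radical_iff_polar]
    rintro ⟨x', y'⟩
    simp [QuadraticMap.polar_prod, (mem_radical_iff_polar Q).1 hx, (mem_radical_iff_polar R).1 hy]
  have hr' := Submodule.finrank_mono hr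
  rw [finrank_submodule_prod] at hr'
  have e1 := sigPos_add_sigNeg_add_radical (Q := Q)
  have e2 := sigPos_add_sigNeg_add_radical (Q := R)
  have e3 := sigPos_add_sigNeg_add_radical (Q := QuadraticMap.prod Q R)
  rw [Module.finrank_prod] at e3
  rw [signature, signature, signature]
  omega

lemma qSignature_eq_signature (Q : QuadraticForm ℝ M) (q : M → ℝ) (h : ∀ x, Q x = q x) :
    qSignature q = signature Q := by
  have key : ∀ (R : QuadraticForm ℝ M) (r : M → ℝ), (∀ x, R x = r x) → posIdx r = sigPos R := by
    intro R r hR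
    refine Eq.trans (congrArg sSup ?_) (sigPos_isGreatest R).csSup_eq
    ext n
    refine exists_congr fun U => and_congr_right fun _ => ?_
    simp [QuadraticMap.PosDef, hR]
  rw [qSignature, signature, key Q q h, key (-Q) (fun x => -q x) (by simp [h]), sigPos_neg]

end

end QuadraticForm

section Maslov

open QuadraticForm

variable {V : Type*} [AddCommGroup V] [Module ℝ V]

lemma skew_of_alternating {ω : V →ₗ[ℝ] V →ₗ[ℝ] ℝ} (halt : ∀ v, ω v v = 0) (x y : V) :
    ω x y = -ω y x := by
  have h := halt (x + y)
  simp only [map_add, LinearMap.add_apply, halt] at h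
  linarith

lemma nondegenerate_of_alternating {ω : V →ₗ[ℝ] V →ₗ[ℝ] ℝ}
    (halt : ∀ v, ω v v = 0)
    (hnd : ∀ v, (∀ w, ω v w = 0) → v = 0) : LinearMap.BilinForm.Nondegenerate ω :=
  ⟨hnd, fun v h => hnd v fun w => by rw [skew_of_alternating halt, h w, neg_zero]⟩

lemma isRefl_of_alternating {ω : V →ₗ[ℝ] V →ₗ[ℝ] ℝ}
    (halt : ∀ v, ω v v = 0) : LinearMap.BilinForm.IsRefl ω :=
  fun x y h => by rw [skew_of_alternating halt, h, neg_zero]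

/-- The Kashiwara form on `L₁ ⊕ L₂ ⊕ L₃`, as a quadratic form. -/
noncomputable def kashiwaraForm (ω : V →ₗ[ℝ] V →ₗ[ℝ] ℝ) (L₁ L₂ L₃ : Submodule ℝ V) :
    QuadraticForm ℝ (L₁ × L₂ × L₃) :=
  let p₁ := L₁.subtype ∘ₗ LinearMap.fst ℝ L₁ (L₂ × L₃)
  let p₂ := L₂.subtype ∘ₗ LinearMap.fst ℝ L₂ L₃ ∘ₗ LinearMap.snd ℝ L₁ (L₂ × L₃)
  let p₃ := L₃.subtype ∘ₗ LinearMap.snd ℝ L₂ L₃ ∘ₗ LinearMap.snd ℝ L₁ (L₂ × L₃)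
  LinearMap.BilinMap.toQuadraticMap
    (ω.compl₁₂ p₁ p₂ + ω.compl₁₂ p₂ p₃ + ω.compl₁₂ p₃ p₁)

@[simp] lemma kashiwaraForm_apply (ω : V →ₗ[ℝ] V →ₗ[ℝ] ℝ) (L₁ L₂ L₃ : Submodule ℝ V)
    (x : L₁ × L₂ × L₃) : kashiwaraForm ω L₁ L₂ L₃ x =
      ω (x.1 : V) (x.2.1 : V) + ω (x.2.1 : V) (x.2.2 : V) + ω (x.2.2 : V) (x.1 : V) := rfl

/-- Pairs `(x₁, x₂)` in `L₁ × L₂` with `x₁ + x₂ ∈ L₃`; these are the triples in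
`L₁ × L₂ × L₃` with zero sum. -/
def triangleSpace (L₁ L₂ L₃ : Submodule ℝ V) : Submodule ℝ (V × V) :=
  L₁.prod L₂ ⊓ L₃.comap (LinearMap.fst ℝ V V + LinearMap.snd ℝ V V)

lemma mem_triangleSpace {L₁ L₂ L₃ : Submodule ℝ V} {x : V × V} :
    x ∈ triangleSpace L₁ L₂ L₃ ↔ (x.1 ∈ L₁ ∧ x.2 ∈ L₂) ∧ x.1 + x.2 ∈ L₃ := Iff.rfl

/-- The quadratic form `ω(x₁, x₂)` on zero-sum triples. -/
noncomputable def triangleForm (ω : V →ₗ[ℝ] V →ₗ[ℝ] ℝ) (L₁ L₂ L₃ : Submodule ℝ V) :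
    QuadraticForm ℝ (triangleSpace L₁ L₂ L₃) :=
  (LinearMap.BilinMap.toQuadraticMap
    (ω.compl₁₂ (LinearMap.fst ℝ V V) (LinearMap.snd ℝ V V))).restrict _

@[simp] lemma triangleForm_apply (ω : V →ₗ[ℝ] V →ₗ[ℝ] ℝ) (L₁ L₂ L₃ : Submodule ℝ V)
    (x : triangleSpace L₁ L₂ L₃) : triangleForm ω L₁ L₂ L₃ x = ω (x : V × V).1 (x : V × V).2 := rfl

/-- Triples `(x₁, x₂, x₃)` in `L₁ × L₂ × L₃` with `x₁ + x₂ + x₃ ∈ L₄`; these are the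
quadruples in `L₁ × L₂ × L₃ × L₄` with zero sum. -/
def quadrangleSpace (L₁ L₂ L₃ L₄ : Submodule ℝ V) : Submodule ℝ (V × V × V) :=
  L₁.prod (L₂.prod L₃) ⊓ L₄.comap (LinearMap.fst ℝ V (V × V) +
    (LinearMap.fst ℝ V V + LinearMap.snd ℝ V V) ∘ₗ LinearMap.snd ℝ V (V × V))

lemma mem_quadrangleSpace {L₁ L₂ L₃ L₄ : Submodule ℝ V} {x : V × V × V} :
    x ∈ quadrangleSpace L₁ L₂ L₃ L₄ ↔
      (x.1 ∈ L₁ ∧ x.2.1 ∈ L₂ ∧ x.2.2 ∈ L₃) ∧ x.1 + (x.2.1 + x.2.2) ∈ L₄ := Iff.rfl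

/-- The quadratic form `ω(x₁, x₂) + ω(x₁, x₃) + ω(x₂, x₃)` on zero-sum quadruples. -/
noncomputable def quadrangleForm (ω : V →ₗ[ℝ] V →ₗ[ℝ] ℝ) (L₁ L₂ L₃ L₄ : Submodule ℝ V) :
    QuadraticForm ℝ (quadrangleSpace L₁ L₂ L₃ L₄) :=
  let p₁ := LinearMap.fst ℝ V (V × V)
  let p₂ := LinearMap.fst ℝ V V ∘ₗ LinearMap.snd ℝ V (V × V)
  let p₃ := LinearMap.snd ℝ V V ∘ₗ LinearMap.snd ℝ V (V × V)
  (LinearMap.BilinMap.toQuadraticMap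
    (ω.compl₁₂ p₁ p₂ + ω.compl₁₂ p₁ p₃ + ω.compl₁₂ p₂ p₃)).restrict _

@[simp] lemma quadrangleForm_apply (ω : V →ₗ[ℝ] V →ₗ[ℝ] ℝ) (L₁ L₂ L₃ L₄ : Submodule ℝ V)
    (x : quadrangleSpace L₁ L₂ L₃ L₄) : quadrangleForm ω L₁ L₂ L₃ L₄ x =
      ω (x : V × V × V).1 (x : V × V × V).2.1 + ω (x : V × V × V).1 (x : V × V × V).2.2 +
        ω (x : V × V × V).2.1 (x : V × V × V).2.2 := rfl

variable [FiniteDimensional ℝ V] {ω : V →ₗ[ℝ] V →ₗ[ℝ] ℝ}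

lemma signature_triangleForm_rotate (halt : ∀ v, ω v v = 0) (L₁ L₂ L₃ : Submodule ℝ V) :
    signature (triangleForm ω L₁ L₂ L₃) = signature (triangleForm ω L₂ L₃ L₁) := by
  let g : triangleSpace L₁ L₂ L₃ →ₗ[ℝ] triangleSpace L₂ L₃ L₁ :=
    (((LinearMap.snd ℝ V V).prod (-(LinearMap.fst ℝ V V + LinearMap.snd ℝ V V))) ∘ₗ
      Submodule.subtype _).codRestrict _ (by
        rintro ⟨⟨x₁, x₂⟩, ⟨h₁, h₂⟩, h₃⟩
        refine mem_triangleSpace.2 ⟨⟨h₂, L₃.neg_mem h₃⟩, ?_⟩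
        convert L₁.neg_mem h₁ using 1
        simp)
  rw [← signature_comp_of_surjective (triangleForm ω L₂ L₃ L₁) g]
  · congr 1
    ext ⟨⟨x₁, x₂⟩, h⟩
    simp [g, halt, skew_of_alternating halt x₂ x₁]
  · rintro ⟨⟨x₂, x₃⟩, ⟨h₂, h₃⟩, h₁⟩
    refine ⟨⟨(-(x₂ + x₃), x₂), ⟨L₁.neg_mem h₁, h₂⟩, ?_⟩, ?_⟩
    · convert L₃.neg_mem h₃ using 1
      simp
    · ext <;> simp [g]

lemma signature_quadrangleForm_rotate (halt : ∀ v, ω v v = 0) (L₁ L₂ L₃ L₄ : Submodule ℝ V) :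
    signature (quadrangleForm ω L₁ L₂ L₃ L₄) = signature (quadrangleForm ω L₂ L₃ L₄ L₁) := by
  let p₁ := LinearMap.fst ℝ V (V × V)
  let p₂ := LinearMap.fst ℝ V V ∘ₗ LinearMap.snd ℝ V (V × V)
  let p₃ := LinearMap.snd ℝ V V ∘ₗ LinearMap.snd ℝ V (V × V)
  let g : quadrangleSpace L₁ L₂ L₃ L₄ →ₗ[ℝ] quadrangleSpace L₂ L₃ L₄ L₁ :=
    ((p₂.prod (p₃.prod (-(p₁ + (p₂ + p₃))))) ∘ₗ
      Submodule.subtype _).codRestrict _ (by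
        rintro ⟨⟨x₁, x₂, x₃⟩, ⟨h₁, h₂, h₃⟩, h₄⟩
        refine mem_quadrangleSpace.2 ⟨⟨h₂, h₃, L₄.neg_mem h₄⟩, ?_⟩
        convert L₁.neg_mem h₁ using 1
        simp [p₁, p₂, p₃]
        abel)
  rw [← signature_comp_of_surjective (quadrangleForm ω L₂ L₃ L₄ L₁) g]
  · congr 1
    ext ⟨⟨x₁, x₂, x₃⟩, h⟩
    simp only [g, p₁, p₂, p₃, QuadraticMap.comp_apply, quadrangleForm_apply,
      LinearMap.codRestrict_apply, LinearMap.comp_apply, Submodule.subtype_apply,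
      LinearMap.prod_apply, Function.prod_apply, LinearMap.neg_apply, LinearMap.add_apply,
      LinearMap.fst_apply, LinearMap.snd_apply, map_neg, map_add, halt]
    linarith [skew_of_alternating halt x₂ x₁, skew_of_alternating halt x₃ x₁,
      skew_of_alternating halt x₃ x₂]
  · rintro ⟨⟨x₂, x₃, x₄⟩, ⟨h₂, h₃, h₄⟩, h₁⟩
    refine ⟨⟨(-(x₂ + (x₃ + x₄)), x₂, x₃), ⟨L₁.neg_mem h₁, h₂, h₃⟩, ?_⟩, ?_⟩
    · convert L₄.neg_mem h₄ using 1
      simp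
    · ext
      · simp [g, p₂]
      · simp [g, p₃]
      · simp [g, p₁, p₂, p₃]

/-- A Lagrangian subspace is its own orthogonal. -/
lemma IsLagrangianSub.orthogonal_eq (halt : ∀ v, ω v v = 0)
    (hnd : ∀ v, (∀ w, ω v w = 0) → v = 0) {L : Submodule ℝ V} (hL : IsLagrangianSub ω L) :
    LinearMap.BilinForm.orthogonal ω L = L := by
  refine (Submodule.eq_of_le_of_finrank_eq (fun x hx => ?_) ?_).symm
  · exact LinearMap.BilinForm.mem_orthogonal_iff.2 fun y hy => hL.1 y hy x hx
  · rw [LinearMap.BilinForm.finrank_orthogonal (nondegenerate_of_alternating halt hnd)]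
    have := hL.2
    omega

lemma IsLagrangianSub.mem_iff (halt : ∀ v, ω v v = 0)
    (hnd : ∀ v, (∀ w, ω v w = 0) → v = 0) {L : Submodule ℝ V} (hL : IsLagrangianSub ω L) {x : V} :
    x ∈ L ↔ ∀ y ∈ L, ω y x = 0 := by
  conv_lhs => rw [← hL.orthogonal_eq halt hnd]
  exact LinearMap.BilinForm.mem_orthogonal_iff

lemma IsLagrangianSub.mem_sup_of_forall_inf (halt : ∀ v, ω v v = 0)
    (hnd : ∀ v, (∀ w, ω v w = 0) → v = 0) {L L' : Submodule ℝ V} (hL : IsLagrangianSub ω L)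
    (hL' : IsLagrangianSub ω L') {x : V} (hx : ∀ a ∈ L ⊓ L', ω a x = 0) : x ∈ L ⊔ L' := by
  rw [← LinearMap.BilinForm.orthogonal_orthogonal (nondegenerate_of_alternating halt hnd)
    (isRefl_of_alternating halt) (L ⊔ L'), LinearMap.BilinForm.mem_orthogonal_iff]
  intro a ha
  refine hx a ⟨?_, ?_⟩
  · rw [← hL.orthogonal_eq halt hnd]
    exact LinearMap.BilinForm.orthogonal_le le_sup_left ha
  · rw [← hL'.orthogonal_eq halt hnd]
    exact LinearMap.BilinForm.orthogonal_le le_sup_right ha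

/-- The Maslov index is computed by the form `ω(x₁, x₂)` on zero-sum triples. -/
lemma maslovIndex_eq_neg_signature (halt : ∀ v, ω v v = 0)
    (hnd : ∀ v, (∀ w, ω v w = 0) → v = 0) {L₁ L₂ L₃ : Submodule ℝ V}
    (h₁ : IsLagrangianSub ω L₁) :
    maslovIndex ω L₁ L₂ L₃ = -signature (triangleForm ω L₁ L₂ L₃) := by
  rw [maslovIndex, qSignature_eq_signature (kashiwaraForm ω L₁ L₂ L₃) _
    (kashiwaraForm_apply ω L₁ L₂ L₃), ← signature_neg]
  let d : L₁ × L₂ × L₃ →ₗ[ℝ] V :=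
    L₃.subtype ∘ₗ LinearMap.snd ℝ L₂ L₃ ∘ₗ LinearMap.snd ℝ L₁ (L₂ × L₃) -
      L₂.subtype ∘ₗ LinearMap.fst ℝ L₂ L₃ ∘ₗ LinearMap.snd ℝ L₁ (L₂ × L₃)
  let N : Submodule ℝ (L₁ × L₂ × L₃) := L₁.comap d
  let g : N →ₗ[ℝ] triangleSpace L₁ L₂ L₃ :=
    ((d.prod (L₂.subtype ∘ₗ LinearMap.fst ℝ L₂ L₃ ∘ₗ LinearMap.snd ℝ L₁ (L₂ × L₃))) ∘ₗ
      N.subtype).codRestrict _ (by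
        rintro ⟨⟨x₁, x₂, x₃⟩, h⟩
        refine mem_triangleSpace.2 ⟨⟨h, x₂.2⟩, ?_⟩
        convert x₃.2 using 1
        simp [d])
  have hg : Function.Surjective g := by
    rintro ⟨⟨x₁, x₂⟩, ⟨hx₁, hx₂⟩, hx₃⟩
    refine ⟨⟨(0, ⟨x₂, hx₂⟩, ⟨x₁ + x₂, hx₃⟩), ?_⟩, ?_⟩
    · change x₁ + x₂ - x₂ ∈ L₁
      simpa using hx₁
    · ext <;> simp [g, d]
  rw [← signature_comp_of_surjective _ g hg]
  symm
  have hpolar : ∀ (i : L₁ × L₂ × L₃), i ∈ LinearMap.range (LinearMap.inl ℝ L₁ (L₂ × L₃)) → ∀ x,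
      QuadraticMap.polar (kashiwaraForm ω L₁ L₂ L₃) i x = -ω (i.1 : V) (d x) := by
    rintro _ ⟨a, rfl⟩ ⟨x₁, x₂, x₃⟩
    simp [QuadraticMap.polar, d]
    linarith [skew_of_alternating halt x₃ a]
  refine signature_eq_of_range_eq_orthogonal _ _ N.subtype ?_
    (LinearMap.range (LinearMap.inl ℝ L₁ (L₂ × L₃))) ?_ ?_ ?_
  · rintro ⟨⟨x₁, x₂, x₃⟩, h⟩
    have h0 := h₁.1 x₁ x₁.2 _ h
    simp [d] at h0
    simp [g, d, halt]
    linarith [skew_of_alternating halt x₃ x₁, skew_of_alternating halt x₃ x₂]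
  · rintro _ ⟨a, rfl⟩
    simp
  · intro y i hi
    rw [hpolar i hi, N.subtype_apply, h₁.1 _ i.1.2 _ y.2, neg_zero]
  · intro x hx
    refine ⟨⟨x, (h₁.mem_iff halt hnd).2 fun a ha => ?_⟩, rfl⟩
    have h := hpolar _ ⟨⟨a, ha⟩, rfl⟩ x
    rw [hx _ ⟨⟨a, ha⟩, rfl⟩] at h
    simpa using h.symm

/-- Cutting a quadrangle along its diagonal. -/
lemma signature_quadrangleForm (halt : ∀ v, ω v v = 0)
    (hnd : ∀ v, (∀ w, ω v w = 0) → v = 0) {L₁ L₂ L₃ L₄ : Submodule ℝ V}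
    (h₁ : IsLagrangianSub ω L₁) (h₃ : IsLagrangianSub ω L₃) :
    signature (quadrangleForm ω L₁ L₂ L₃ L₄) =
      signature (triangleForm ω L₁ L₂ L₃) + signature (triangleForm ω L₁ L₃ L₄) := by
  rw [← signature_prod]
  let x := Submodule.subtype _ ∘ₗ
    LinearMap.fst ℝ (triangleSpace L₁ L₂ L₃) (triangleSpace L₁ L₃ L₄)
  let y := Submodule.subtype _ ∘ₗ
    LinearMap.snd ℝ (triangleSpace L₁ L₂ L₃) (triangleSpace L₁ L₃ L₄)
  let p := LinearMap.fst ℝ V V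
  let q := LinearMap.snd ℝ V V
  let f : triangleSpace L₁ L₂ L₃ × triangleSpace L₁ L₃ L₄ →ₗ[ℝ] quadrangleSpace L₁ L₂ L₃ L₄ :=
    ((p ∘ₗ x + p ∘ₗ y).prod ((q ∘ₗ x).prod (q ∘ₗ y - (p + q) ∘ₗ x))).codRestrict _ (by
      rintro ⟨⟨⟨x₁, x₂⟩, ⟨hx₁, hx₂⟩, hx₃⟩, ⟨⟨y₁, y₃⟩, ⟨hy₁, hy₃⟩, hy₄⟩⟩
      refine mem_quadrangleSpace.2 ⟨⟨L₁.add_mem hx₁ hy₁, hx₂, L₃.sub_mem hy₃ hx₃⟩, ?_⟩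
      convert hy₄ using 1
      simp [p, q, x, y]
      abel_nf)
  let I : Submodule ℝ (quadrangleSpace L₁ L₂ L₃ L₄) :=
    ((L₁ ⊓ L₃).map (LinearMap.id.prod ((0 : V →ₗ[ℝ] V).prod (-LinearMap.id)))).comap
      (Submodule.subtype _)
  have hI : ∀ a ∈ L₁ ⊓ L₃, (a, 0, -a) ∈ quadrangleSpace L₁ L₂ L₃ L₄ := fun a ha =>
    mem_quadrangleSpace.2 ⟨⟨ha.1, L₂.zero_mem, L₃.neg_mem ha.2⟩, by simp⟩
  have hpolar : ∀ a (ha : a ∈ L₁ ⊓ L₃) (z : quadrangleSpace L₁ L₂ L₃ L₄),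
      QuadraticMap.polar (quadrangleForm ω L₁ L₂ L₃ L₄) ⟨_, hI a ha⟩ z =
        2 * ω a (z : V × V × V).2.1 := by
    rintro a ha ⟨⟨z₁, z₂, z₃⟩, ⟨hz₁, hz₂, hz₃⟩, hz₄⟩
    have e₁ := h₁.1 a ha.1 z₁ hz₁
    have e₃ := h₃.1 a ha.2 z₃ hz₃
    simp [QuadraticMap.polar, halt]
    linarith [skew_of_alternating halt z₁ a, skew_of_alternating halt z₂ a]
  symm
  refine signature_eq_of_range_eq_orthogonal _ _ f ?_ I ?_ ?_ ?_
  · rintro ⟨⟨⟨x₁, x₂⟩, ⟨hx₁, hx₂⟩, hx₃⟩, ⟨⟨y₁, y₃⟩, ⟨hy₁, hy₃⟩, hy₄⟩⟩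
    have e₁ := h₁.1 x₁ hx₁ y₁ hy₁
    have e₃ := h₃.1 _ hx₃ y₃ hy₃
    simp at e₃
    simp [f, p, q, x, y, halt]
    linarith [skew_of_alternating halt x₂ x₁, skew_of_alternating halt y₁ x₁]
  · rintro ⟨_, _⟩ ⟨a, ha, rfl⟩
    simp [halt]
  · rintro ⟨⟨⟨x₁, x₂⟩, ⟨hx₁, hx₂⟩, hx₃⟩, w⟩ ⟨_, _⟩ ⟨a, ha, rfl⟩
    refine (hpolar a ha _).trans ?_
    have e₁ := h₁.1 a ha.1 x₁ hx₁
    have e₃ := h₃.1 a ha.2 _ hx₃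
    simp at e₃
    simp [f, q, x]
    linarith
  · rintro ⟨⟨z₁, z₂, z₃⟩, ⟨hz₁, hz₂, hz₃⟩, hz₄⟩ hz
    have hz₂' : z₂ ∈ L₁ ⊔ L₃ := h₁.mem_sup_of_forall_inf halt hnd h₃ fun a ha => by
      have h := hpolar a ha ⟨⟨z₁, z₂, z₃⟩, ⟨hz₁, hz₂, hz₃⟩, hz₄⟩
      rw [hz _ ⟨a, ha, by simp⟩] at h
      simpa using h.symm
    obtain ⟨a, ha, c, hc, rfl⟩ := Submodule.mem_sup.1 hz₂'
    refine ⟨(⟨(-a, a + c), ⟨L₁.neg_mem ha, hz₂⟩, ?_⟩,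
      ⟨(z₁ + a, z₃ + c), ⟨L₁.add_mem hz₁ ha, L₃.add_mem hz₃ hc⟩, ?_⟩), ?_⟩
    · simpa using hc
    · convert hz₄ using 1
      simp
      abel_nf
    · ext <;> simp [f, p, q, x, y]

end Maslov

/-- The cocycle identity for the Maslov-Kashiwara index:
`τ(L₁,L₂,L₃) − τ(L₁,L₂,L₄) + τ(L₁,L₃,L₄) − τ(L₂,L₃,L₄) = 0`. -/
theorem stmt_9 (V : Type*) [AddCommGroup V] [Module ℝ V] [FiniteDimensional ℝ V]
    (ω : V →ₗ[ℝ] V →ₗ[ℝ] ℝ) (halt : ∀ v : V, ω v v = 0)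
    (hnd : ∀ v : V, (∀ w : V, ω v w = 0) → v = 0)
    (L₁ L₂ L₃ L₄ : Submodule ℝ V)
    (h1 : IsLagrangianSub ω L₁) (h2 : IsLagrangianSub ω L₂)
    (h3 : IsLagrangianSub ω L₃) (h4 : IsLagrangianSub ω L₄) :
    maslovIndex ω L₁ L₂ L₃ - maslovIndex ω L₁ L₂ L₄ + maslovIndex ω L₁ L₃ L₄
      - maslovIndex ω L₂ L₃ L₄ = 0 := by
  rw [maslovIndex_eq_neg_signature halt hnd h1, maslovIndex_eq_neg_signature halt hnd h1,
    maslovIndex_eq_neg_signature halt hnd h1, maslovIndex_eq_neg_signature halt hnd h2]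
  have h13 := signature_quadrangleForm (L₂ := L₂) (L₄ := L₄) halt hnd h1 h3
  have h24 := signature_quadrangleForm (L₂ := L₃) (L₄ := L₁) halt hnd h2 h4
  have hrot := signature_quadrangleForm_rotate halt L₁ L₂ L₃ L₄
  have hrot' := signature_triangleForm_rotate halt L₁ L₂ L₄
  linarith
end
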